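/- (Local supporting hyperboloids are global.) Suppose u : Ω → [0,τ₀] is a parallel refractor under the structural setup, the target satisfies the Lipschitz parametrization, and the condition (AW) holds from X₀ = (x₀, u(x₀)) for some x₀ ∈ Ω. If there exist Y₀ ∈ Σ and ε > 0 such that u(x) ≥ φ(x, Y₀, X₀) for all x ∈ B_ε(x₀), then u(x) ≥ φ(x, Y₀, X₀) for all x ∈ Ω; that is, Y₀ belongs to the refractor-normal image F_u(x₀). -/

import Mathlib

noncomputable section

open scoped RealInnerProductSpace

/-- ℝⁿ with the Euclidean norm. -/
abbrev E (n : ℕ) : Type := EuclideanSpace ℝ (Fin n)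

/-- Euclidean norm of a point of ℝ^{n+1} = ℝⁿ × ℝ. -/
def pnorm {n : ℕ} (W : E n × ℝ) : ℝ := Real.sqrt (‖W.1‖ ^ 2 + W.2 ^ 2)

/-- c(X,Y) = κ(y_{n+1} − x_{n+1}) − |X − Y|. -/
def cfun {n : ℕ} (κ : ℝ) (X Y : E n × ℝ) : ℝ := κ * (Y.2 - X.2) - pnorm (X - Y)

/-- φ_{Y,b}(x): lower sheet of the two-sheeted hyperboloid with upper focus Y. -/
def hypb {n : ℕ} (κ : ℝ) (Y : E n × ℝ) (b : ℝ) (x : E n) : ℝ :=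
  Y.2 - κ * b / (κ ^ 2 - 1) -
    Real.sqrt (b ^ 2 / (κ ^ 2 - 1) ^ 2 + ‖x - Y.1‖ ^ 2 / (κ ^ 2 - 1))

/-- φ(x, Y, X₀) = φ_{Y, c(X₀,Y)}(x). -/
def hyp {n : ℕ} (κ : ℝ) (x : E n) (Y X₀ : E n × ℝ) : ℝ := hypb κ Y (cfun κ X₀ Y) x

/-- Q(v) = (κ − √(1 − (κ²−1)|v|²))/(1 + |v|²). -/
def Qf {n : ℕ} (κ : ℝ) (v : E n) : ℝ :=
  (κ - Real.sqrt (1 - (κ ^ 2 - 1) * ‖v‖ ^ 2)) / (1 + ‖v‖ ^ 2)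

/-- Λ(v) = (Q(v)v, −Q(v) + κ), the refracted unit direction. -/
def Λf {n : ℕ} (κ : ℝ) (v : E n) : E n × ℝ := (Qf κ v • v, κ - Qf κ v)

/-- The point of the target in the direction Λ(v) from Z: Y(v) = Z + s_Z(Λ(v))Λ(v). -/
def YofZ {n : ℕ} (κ : ℝ) (sfun : (E n × ℝ) → (E n × ℝ) → ℝ) (Z : E n × ℝ)
    (v : E n) : E n × ℝ :=
  Z + sfun Z (Λf κ v) • Λf κ v

/-- The point Y_Z(λ) on the "segment" [Ȳ, Ŷ]_Z obtained by interpolating the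
gradients v̄ = D_xφ(z, Ȳ, Z), v̂ = D_xφ(z, Ŷ, Z). -/
def YZlam {n : ℕ} (κ : ℝ) (sfun : (E n × ℝ) → (E n × ℝ) → ℝ) (Z : E n × ℝ)
    (Yb Yh : E n × ℝ) (lam : ℝ) : E n × ℝ :=
  YofZ κ sfun Z ((1 - lam) • gradient (fun z => hyp κ z Yb Z) Z.1
    + lam • gradient (fun z => hyp κ z Yh Z) Z.1)

/-- Second derivative (Hessian bilinear form) of f at x in directions ξ, η. -/
def hess {n : ℕ} (f : E n → ℝ) (x : E n) (ξ η : E n) : ℝ :=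
  fderiv ℝ (fun z => fderiv ℝ f z η) x ξ


lemma le_of_sq_le_sq0 {a b : ℝ} (h : a ^ 2 ≤ b ^ 2) (hb : 0 ≤ b) : a ≤ b := (abs_le_of_sq_le_sq' h hb).2

lemma pnorm_sq {n : ℕ} (W : E n × ℝ) : pnorm W ^ 2 = ‖W.1‖ ^ 2 + W.2 ^ 2 := by
  unfold pnorm
  exact Real.sq_sqrt (by positivity)

lemma pnorm_nonneg {n : ℕ} (W : E n × ℝ) : 0 ≤ pnorm W := Real.sqrt_nonneg _

/-- κ|X - Y| - (y_{n+1} - x_{n+1}). -/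
def qf {n : ℕ} (κ : ℝ) (X Y : E n × ℝ) : ℝ := κ * pnorm (X - Y) - (Y.2 - X.2)

lemma qf_pos {n : ℕ} {κ : ℝ} (hκ : 1 < κ) {X Y : E n × ℝ} (h : X.2 < Y.2) : 0 < qf κ X Y := by
  unfold qf
  have h1 := pnorm_sq (X - Y)
  have h2 := pnorm_nonneg (X - Y)
  have h3 : Y.2 - X.2 ≤ pnorm (X - Y) := by
    apply le_of_sq_le_sq0 <;> simp at * <;> nlinarith [sq_nonneg ‖X.1 - Y.1‖]
  nlinarith

lemma hypb_eq {n : ℕ} {κ : ℝ} (hκ : 1 < κ) (Y : E n × ℝ) (b : ℝ) (x : E n) :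
    hypb κ Y b x = Y.2 - κ * b / (κ ^ 2 - 1)
      - Real.sqrt (b ^ 2 + (κ ^ 2 - 1) * ‖x - Y.1‖ ^ 2) / (κ ^ 2 - 1) := by
  have hK : 0 < κ ^ 2 - 1 := by nlinarith
  unfold hypb
  congr 1
  rw [show b ^ 2 / (κ ^ 2 - 1) ^ 2 + ‖x - Y.1‖ ^ 2 / (κ ^ 2 - 1)
      = (b ^ 2 + (κ ^ 2 - 1) * ‖x - Y.1‖ ^ 2) / (κ ^ 2 - 1) ^ 2 by field_simp]
  rw [Real.sqrt_div' _ (by positivity), Real.sqrt_sq hK.le]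

lemma norm_shift {n : ℕ} (x x0 y : E n) :
    ‖x - y‖ ^ 2 = ‖x0 - y‖ ^ 2 + (‖x - x0‖ ^ 2 - 2 * ⟪x - x0, y - x0⟫) := by
  have : x - y = (x - x0) - (y - x0) := by abel
  rw [this, norm_sub_sq_real, norm_sub_rev y x0]
  ring

lemma hyp_eq {n : ℕ} {κ : ℝ} (hκ : 1 < κ) (x : E n) (Y X : E n × ℝ) :
    hyp κ x Y X = X.2 + (qf κ X Y - Real.sqrt (qf κ X Y ^ 2
      + (κ ^ 2 - 1) * (‖x - X.1‖ ^ 2 - 2 * ⟪x - X.1, Y.1 - X.1⟫))) / (κ ^ 2 - 1) := by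
  have hK : 0 < κ ^ 2 - 1 := by nlinarith
  unfold hyp
  rw [hypb_eq hκ, norm_shift x X.1 Y.1]
  have h1 := pnorm_sq (X - Y)
  simp only [Prod.fst_sub, Prod.snd_sub] at h1
  have : cfun κ X Y ^ 2 + (κ ^ 2 - 1) * (‖X.1 - Y.1‖ ^ 2 +
      (‖x - X.1‖ ^ 2 - 2 * ⟪x - X.1, Y.1 - X.1⟫)) = qf κ X Y ^ 2
      + (κ ^ 2 - 1) * (‖x - X.1‖ ^ 2 - 2 * ⟪x - X.1, Y.1 - X.1⟫) := by
    unfold cfun qf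
    linear_combination (1 - κ ^ 2) * h1
  rw [this]
  unfold cfun qf
  field_simp
  ring

lemma hyp_self {n : ℕ} {κ : ℝ} (hκ : 1 < κ) {Y X : E n × ℝ} (h : X.2 < Y.2) :
    hyp κ X.1 Y X = X.2 := by
  rw [hyp_eq hκ]
  simp [Real.sqrt_sq (qf_pos hκ h).le]

/-- the basic algebraic description of `φ(x,Y,X) ≤ X.2 + t`. -/
lemma hyp_le_iff {n : ℕ} {κ : ℝ} (hκ : 1 < κ) {Y X : E n × ℝ} (h : X.2 < Y.2)
    (hv : (κ ^ 2 - 1) * ‖Y.1 - X.1‖ ^ 2 ≤ qf κ X Y ^ 2) (x : E n) (t : ℝ)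
    (ht : (κ ^ 2 - 1) * t ^ 2 ≤ ‖x - X.1‖ ^ 2) :
    hyp κ x Y X ≤ X.2 + t ↔
      2 * ⟪x - X.1, Y.1 - X.1⟫ ≤ 2 * t * qf κ X Y + (‖x - X.1‖ ^ 2 - (κ ^ 2 - 1) * t ^ 2) := by
  have hK : 0 < κ ^ 2 - 1 := by nlinarith
  have hq := qf_pos hκ h
  rw [hyp_eq hκ]
  set q := qf κ X Y
  set K := κ ^ 2 - 1
  have hcs := real_inner_le_norm (x - X.1) (Y.1 - X.1)
  set p := ⟪x - X.1, Y.1 - X.1⟫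
  set H := ‖x - X.1‖
  set a := ‖Y.1 - X.1‖
  have hH : 0 ≤ H := norm_nonneg _
  have ha : 0 ≤ a := norm_nonneg _
  have e1 : X.2 + (q - Real.sqrt (q ^ 2 + K * (H ^ 2 - 2 * p))) / K ≤ X.2 + t ↔
      q - K * t ≤ Real.sqrt (q ^ 2 + K * (H ^ 2 - 2 * p)) := by
    rw [add_le_add_iff_left, div_le_iff₀ hK]
    constructor <;> intro h <;> linarith
  rw [e1]
  constructor
  · intro h1
    by_cases h2 : 0 ≤ q - K * t
    · have := (Real.le_sqrt' (x := q - K * t) (y := q ^ 2 + K * (H ^ 2 - 2 * p)))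
      rcases h2.eq_or_lt with h3 | h3
      · have hqt : q = K * t := by linarith
        -- K t = q
        obtain ⟨s, hs, hsK⟩ : ∃ s : ℝ, 0 < s ∧ s ^ 2 = K := ⟨√K, Real.sqrt_pos.2 hK, Real.sq_sqrt hK.le⟩
        have h4 : H * a ≤ H * (q / s) := by
          apply mul_le_mul_of_nonneg_left _ hH
          rw [le_div_iff₀ hs]
          apply le_of_sq_le_sq0 
          · nlinarith
          · exact hq.le
        have h5 : q / s = s * t := by rw [hqt, ← hsK]; field_simp
        rw [h5] at h4
        nlinarith [sq_nonneg (H - s * t)]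
      · have h4 := (this h3).1 h1
        nlinarith
    · push Not at h2
      obtain ⟨s, hs, hsK⟩ : ∃ s : ℝ, 0 < s ∧ s ^ 2 = K := ⟨√K, Real.sqrt_pos.2 hK, Real.sq_sqrt hK.le⟩
      have h4 : H * a ≤ H * (q / s) := by
        apply mul_le_mul_of_nonneg_left _ hH
        rw [le_div_iff₀ hs]
        apply le_of_sq_le_sq0 
        · nlinarith
        · exact hq.le
      have hqs : q / s * s = q := by field_simp
      set w := q / s
      have hw : w < s * t := by
        rw [← hsK] at h2
        by_contra hc
        push Not at hc
        nlinarith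
      have hstH : s * t ≤ H := by
        apply le_of_sq_le_sq0 
        · nlinarith
        · exact hH
      rw [← hqs, ← hsK]
      nlinarith [mul_nonneg (sub_nonneg.2 hstH) (by linarith : 0 ≤ H + s * t - 2 * w)]
  · intro h1
    apply Real.le_sqrt_of_sq_le
    nlinarith

lemma Kpos {κ : ℝ} (hκ : 1 < κ) : 0 < κ ^ 2 - 1 := by nlinarith

lemma qf_sq {n : ℕ} (κ : ℝ) (X Y : E n × ℝ) :
    qf κ X Y ^ 2 = cfun κ X Y ^ 2 + (κ ^ 2 - 1) * ‖Y.1 - X.1‖ ^ 2 := by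
  have h1 := pnorm_sq (X - Y)
  simp only [Prod.fst_sub, Prod.snd_sub] at h1
  rw [norm_sub_rev Y.1 X.1]
  unfold cfun qf
  linear_combination (κ ^ 2 - 1) * h1

lemma cfun_pos {n : ℕ} {κ Δ : ℝ} (hκ : 1 < κ) (hΔ : 0 < Δ) {X Y : E n × ℝ}
    (hr : ‖X.1 - Y.1‖ ≤ Δ) (hT : κ * Δ ≤ (κ - 1) * (Y.2 - X.2)) : 0 < cfun κ X Y := by
  have h1 := pnorm_sq (X - Y)
  simp only [Prod.fst_sub, Prod.snd_sub] at h1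
  unfold cfun
  have h0 : 0 ≤ ‖X.1 - Y.1‖ := norm_nonneg _
  have hT0 : 0 < Y.2 - X.2 := by
    have : 0 < (κ - 1) * (Y.2 - X.2) := by nlinarith
    exact (pos_iff_pos_of_mul_pos this).1 (by linarith)
  have h2 : ‖X.1 - Y.1‖ < (κ - 1) * (Y.2 - X.2) := by nlinarith
  have : pnorm (X - Y) < κ * (Y.2 - X.2) := by
    apply lt_of_pow_lt_pow_left₀ 2 (by positivity)
    have h3 : ‖X.1 - Y.1‖ ^ 2 < ((κ - 1) * (Y.2 - X.2)) ^ 2 := by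
      apply pow_lt_pow_left₀ h2 h0 (by norm_num)
    nlinarith [mul_pos (mul_pos hT0 hT0) (sub_pos.2 hκ)]
  linarith

lemma b_eq_cfun {n : ℕ} {κ b : ℝ} (hκ : 1 < κ) (hb : 0 ≤ b) {X Y : E n × ℝ}
    (h : X.2 = hypb κ Y b X.1) : b = cfun κ X Y := by
  have hK := Kpos hκ
  rw [hypb_eq hκ] at h
  have h1 := pnorm_sq (X - Y)
  simp only [Prod.fst_sub, Prod.snd_sub] at h1
  have hs := Real.sqrt_nonneg (b ^ 2 + (κ ^ 2 - 1) * ‖X.1 - Y.1‖ ^ 2)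
  have hs2 := Real.sq_sqrt (by positivity : 0 ≤ b ^ 2 + (κ ^ 2 - 1) * ‖X.1 - Y.1‖ ^ 2)
  set S := Real.sqrt (b ^ 2 + (κ ^ 2 - 1) * ‖X.1 - Y.1‖ ^ 2)
  have hS : S = (κ ^ 2 - 1) * (Y.2 - X.2) - κ * b := by
    rw [h]; field_simp; ring
  have hp := pnorm_nonneg (X - Y)
  unfold cfun
  have h2 : (κ ^ 2 - 1) * ((κ * (Y.2 - X.2) - b) ^ 2) = (κ ^ 2 - 1) * pnorm (X - Y) ^ 2 := by
    rw [h1]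
    rw [hS] at hs2
    nlinarith
  have h3 := mul_left_cancel₀ hK.ne' h2
  have h4 : 0 ≤ κ * (Y.2 - X.2) - b := by
    have : 0 ≤ (κ ^ 2 - 1) * (κ * (Y.2 - X.2) - b) := by
      have : 0 ≤ κ * S := by positivity
      rw [hS] at this
      nlinarith
    exact nonneg_of_mul_nonneg_right this hK
  have := (pow_left_inj₀ h4 hp (by norm_num)).1 h3
  linarith

lemma pnorm_smul {n : ℕ} {s : ℝ} (hs : 0 ≤ s) (d : E n × ℝ) : pnorm (s • d) = s * pnorm d := by
  have h1 := pnorm_sq (s • d)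
  have h2 := pnorm_sq d
  simp only [Prod.smul_fst, Prod.smul_snd, norm_smul, smul_eq_mul, Real.norm_eq_abs, mul_pow,
    sq_abs] at h1
  apply (pow_left_inj₀ (pnorm_nonneg _) (mul_nonneg hs (pnorm_nonneg _)) (n := 2) (by norm_num)).1
  rw [h1, mul_pow, h2]; ring

lemma pnorm_ray {n : ℕ} {s : ℝ} (hs : 0 ≤ s) {X Y d : E n × ℝ} (hd : pnorm d = 1)
    (h : Y = X + s • d) : pnorm (X - Y) = s := by
  have : pnorm (X - Y) = pnorm (s • d) := by
    unfold pnorm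
    rw [h]
    simp
  rw [this, pnorm_smul hs, hd, mul_one]

/-- gradient of `φ(·,Y,X)` at `X.1`. -/
def vf {n : ℕ} (κ : ℝ) (X Y : E n × ℝ) : E n := (qf κ X Y)⁻¹ • (Y.1 - X.1)

lemma vf_ball {n : ℕ} {κ : ℝ} (hκ : 1 < κ) {X Y : E n × ℝ} (hT : X.2 < Y.2)
    (hc : 0 < cfun κ X Y) : (κ ^ 2 - 1) * ‖vf κ X Y‖ ^ 2 < 1 := by
  have hq := qf_pos hκ hT
  have h1 := qf_sq κ X Y
  unfold vf
  rw [norm_smul, norm_inv, Real.norm_of_nonneg hq.le]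
  rw [mul_pow, inv_pow, mul_left_comm, ← div_eq_inv_mul, div_lt_one (by positivity), h1]
  nlinarith

lemma YofZ_vf {n : ℕ} {κ : ℝ} (hκ : 1 < κ) {sfun : (E n × ℝ) → (E n × ℝ) → ℝ}
    {X Y d : E n × ℝ} (hT : X.2 < Y.2) (hc : 0 < cfun κ X Y) (hs : 0 < sfun X d)
    (hd : pnorm d = 1) (h : Y = X + sfun X d • d) : YofZ κ sfun X (vf κ X Y) = Y := by
  have hp := pnorm_ray hs.le hd h
  have hK := Kpos hκ
  have hq := qf_pos hκ hT
  have hY2 : Y.2 - X.2 = sfun X d * d.2 := by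
    conv_lhs => rw [h]
    simp
  have hY1 : Y.1 - X.1 = sfun X d • d.1 := by
    conv_lhs => rw [h]
    simp
  have hd2 := pnorm_sq d
  rw [hd] at hd2
  have hq' : qf κ X Y = sfun X d * (κ - d.2) := by
    unfold qf; rw [hp, hY2]; ring
  have hc' : cfun κ X Y = sfun X d * (κ * d.2 - 1) := by
    unfold cfun; rw [hp, hY2]; ring
  have hk : 0 < κ - d.2 := by
    rw [hq'] at hq; exact pos_of_mul_pos_right hq hs.le
  have hk2 : 0 < κ * d.2 - 1 := by
    rw [hc'] at hc; exact pos_of_mul_pos_right hc hs.le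
  have hv : vf κ X Y = (κ - d.2)⁻¹ • d.1 := by
    unfold vf
    rw [hq', hY1, smul_smul]
    congr 1
    field_simp
  have hvn : ‖vf κ X Y‖ ^ 2 = (1 - d.2 ^ 2) / (κ - d.2) ^ 2 := by
    rw [hv, norm_smul, norm_inv, Real.norm_of_nonneg hk.le, mul_pow, inv_pow]
    field_simp
    linarith
  have hQ : Qf κ (vf κ X Y) = κ - d.2 := by
    unfold Qf
    rw [hvn]
    have e : 1 - (κ ^ 2 - 1) * ((1 - d.2 ^ 2) / (κ - d.2) ^ 2)
        = ((κ * d.2 - 1) / (κ - d.2)) ^ 2 := by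
      field_simp; ring
    rw [e, Real.sqrt_sq (by positivity)]
    have h5 : 0 < κ ^ 2 - 2 * κ * d.2 + 1 := by
      have : 0 ≤ ‖d.1‖ ^ 2 := by positivity
      nlinarith
    have e2 : 1 + (1 - d.2 ^ 2) / (κ - d.2) ^ 2 = (κ ^ 2 - 2 * κ * d.2 + 1) / (κ - d.2) ^ 2 := by
      field_simp; ring
    have e3 : κ - (κ * d.2 - 1) / (κ - d.2) = (κ ^ 2 - 2 * κ * d.2 + 1) / (κ - d.2) := by
      field_simp; ring
    rw [e2, e3]
    generalize κ ^ 2 - 2 * κ * d.2 + 1 = m at h5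
    field_simp
  have hL : Λf κ (vf κ X Y) = d := by
    unfold Λf
    rw [hQ, hv, smul_smul, mul_inv_cancel₀ hk.ne', one_smul]
    ext <;> simp
  unfold YofZ
  rw [hL, ← h]

lemma Qf_eq {n : ℕ} {κ : ℝ} (hκ : 1 < κ) {v : E n} (hv : (κ ^ 2 - 1) * ‖v‖ ^ 2 < 1) :
    Qf κ v = (κ ^ 2 - 1) / (κ + Real.sqrt (1 - (κ ^ 2 - 1) * ‖v‖ ^ 2)) := by
  have hK := Kpos hκ
  have h0 : 0 < 1 - (κ ^ 2 - 1) * ‖v‖ ^ 2 := by linarith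
  have h1 := Real.sqrt_pos.2 h0
  have h2 := Real.sq_sqrt h0.le
  unfold Qf
  set R := Real.sqrt (1 - (κ ^ 2 - 1) * ‖v‖ ^ 2)
  rw [div_eq_div_iff (by positivity) (by positivity)]
  nlinarith

lemma Qf_pos {n : ℕ} {κ : ℝ} (hκ : 1 < κ) {v : E n} (hv : (κ ^ 2 - 1) * ‖v‖ ^ 2 < 1) :
    0 < Qf κ v := by
  have hK := Kpos hκ
  rw [Qf_eq hκ hv]; positivity

lemma Qf_lt {n : ℕ} {κ : ℝ} (hκ : 1 < κ) {v : E n} (hv : (κ ^ 2 - 1) * ‖v‖ ^ 2 < 1) :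
    0 < κ * (κ - Qf κ v) - 1 := by
  have hK := Kpos hκ
  have h0 : 0 < 1 - (κ ^ 2 - 1) * ‖v‖ ^ 2 := by linarith
  have h1 := Real.sqrt_pos.2 h0
  rw [Qf_eq hκ hv]
  set R := Real.sqrt (1 - (κ ^ 2 - 1) * ‖v‖ ^ 2)
  have : κ * (κ - (κ ^ 2 - 1) / (κ + R)) - 1 = (κ ^ 2 - 1) * R / (κ + R) := by
    field_simp; ring
  rw [this]; positivity

lemma pnorm_Λf {n : ℕ} {κ : ℝ} (hκ : 1 < κ) {v : E n} (hv : (κ ^ 2 - 1) * ‖v‖ ^ 2 < 1) :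
    pnorm (Λf κ v) = 1 := by
  have hK := Kpos hκ
  have h0 : 0 < 1 - (κ ^ 2 - 1) * ‖v‖ ^ 2 := by linarith
  have h1 := Real.sqrt_pos.2 h0
  have h2 := Real.sq_sqrt h0.le
  have hQ := Qf_pos hκ hv
  unfold pnorm Λf
  simp only [norm_smul, Real.norm_of_nonneg hQ.le]
  rw [Real.sqrt_eq_one]
  rw [Qf_eq hκ hv]
  set R := Real.sqrt (1 - (κ ^ 2 - 1) * ‖v‖ ^ 2)
  have : ‖v‖ ^ 2 = (1 - R ^ 2) / (κ ^ 2 - 1) := by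
    field_simp; linarith
  rw [mul_pow, this]
  field_simp
  ring

lemma YofZ_facts {n : ℕ} {κ : ℝ} (hκ : 1 < κ) {sfun : (E n × ℝ) → (E n × ℝ) → ℝ}
    {X : E n × ℝ} {v : E n} (hv : (κ ^ 2 - 1) * ‖v‖ ^ 2 < 1) (hs : 0 < sfun X (Λf κ v)) :
    X.2 < (YofZ κ sfun X v).2 ∧ 0 < cfun κ X (YofZ κ sfun X v) ∧
    qf κ X (YofZ κ sfun X v) = sfun X (Λf κ v) * Qf κ v ∧
    (YofZ κ sfun X v).1 - X.1 = qf κ X (YofZ κ sfun X v) • v ∧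
    (YofZ κ sfun X v).2 - X.2 = sfun X (Λf κ v) * (κ - Qf κ v) := by
  have hp := pnorm_ray hs.le (pnorm_Λf hκ hv) (rfl : YofZ κ sfun X v = X + sfun X (Λf κ v) • Λf κ v)
  have hQ := Qf_pos hκ hv
  have hQ2 := Qf_lt hκ hv
  have e2 : (YofZ κ sfun X v).2 - X.2 = sfun X (Λf κ v) * (κ - Qf κ v) := by
    simp [YofZ, Λf]
  have hq : qf κ X (YofZ κ sfun X v) = sfun X (Λf κ v) * Qf κ v := by
    unfold qf; rw [hp, e2]; ring
  refine ⟨?_, ?_, hq, ?_, e2⟩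
  · have : 0 < κ - Qf κ v := by nlinarith
    have : 0 < sfun X (Λf κ v) * (κ - Qf κ v) := by positivity
    linarith
  · unfold cfun
    rw [hp, e2]
    have : 0 < sfun X (Λf κ v) * (κ * (κ - Qf κ v) - 1) := by positivity
    linarith
  · rw [hq]
    simp [YofZ, Λf, smul_smul]

lemma hypb_continuous {n : ℕ} (κ : ℝ) :
    Continuous (fun Z : ((E n × ℝ) × ℝ) × E n => hypb κ Z.1.1 Z.1.2 Z.2) := by
  unfold hypb
  fun_prop

lemma hypb_concave {n : ℕ} {κ b : ℝ} (hκ : 1 < κ) (hb : 0 < b) (Y : E n × ℝ) (x₀ h : E n) :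
    hypb κ Y b (x₀ + h) ≤ hypb κ Y b x₀ +
      ⟪Y.1 - x₀, h⟫ / Real.sqrt (b ^ 2 + (κ ^ 2 - 1) * ‖x₀ - Y.1‖ ^ 2) := by
  have hK := Kpos hκ
  rw [hypb_eq hκ, hypb_eq hκ, norm_shift (x₀ + h) x₀ Y.1]
  simp only [add_sub_cancel_left]
  rw [real_inner_comm (Y.1 - x₀) h]
  have hcs := real_inner_mul_inner_self_le (Y.1 - x₀) h
  rw [real_inner_self_eq_norm_sq, real_inner_self_eq_norm_sq, norm_sub_rev Y.1 x₀] at hcs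
  set p := ⟪Y.1 - x₀, h⟫
  have hA : 0 < b ^ 2 + (κ ^ 2 - 1) * ‖x₀ - Y.1‖ ^ 2 := by positivity
  have h1 := Real.sqrt_pos.2 hA
  have h2 := Real.sq_sqrt hA.le
  set S := Real.sqrt (b ^ 2 + (κ ^ 2 - 1) * ‖x₀ - Y.1‖ ^ 2)
  have h3 : S - (κ ^ 2 - 1) * p / S ≤ Real.sqrt (b ^ 2 + (κ ^ 2 - 1) * (‖x₀ - Y.1‖ ^ 2 +
      (‖h‖ ^ 2 - 2 * p))) := by
    apply Real.le_sqrt_of_sq_le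
    have e : (S - (κ ^ 2 - 1) * p / S) ^ 2 = S ^ 2 - 2 * (κ ^ 2 - 1) * p
        + (κ ^ 2 - 1) * ((κ ^ 2 - 1) * (p * p) / S ^ 2) := by
      field_simp; ring
    have h4 : (κ ^ 2 - 1) * (p * p) / S ^ 2 ≤ ‖h‖ ^ 2 := by
      rw [div_le_iff₀ (by positivity), h2]
      nlinarith [sq_nonneg ‖h‖, mul_nonneg (sq_nonneg ‖h‖) (sq_nonneg b)]
    have h5 := mul_le_mul_of_nonneg_left h4 hK.le
    rw [e]
    linarith
  set R := Real.sqrt (b ^ 2 + (κ ^ 2 - 1) * (‖x₀ - Y.1‖ ^ 2 + (‖h‖ ^ 2 - 2 * p)))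
  have : (S - (κ ^ 2 - 1) * p / S) / (κ ^ 2 - 1) ≤ R / (κ ^ 2 - 1) := by gcongr
  have e : (S - (κ ^ 2 - 1) * p / S) / (κ ^ 2 - 1) = S / (κ ^ 2 - 1) - p / S := by
    field_simp
  linarith

lemma hyp_lower {n : ℕ} {κ : ℝ} (hκ : 1 < κ) {Y X : E n × ℝ} (hT : X.2 < Y.2) (h : E n) :
    X.2 + ⟪vf κ X Y, h⟫ - ‖h‖ ^ 2 / (2 * qf κ X Y) ≤ hyp κ (X.1 + h) Y X := by
  have hK := Kpos hκ
  have hq := qf_pos hκ hT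
  rw [hyp_eq hκ]
  simp only [add_sub_cancel_left]
  unfold vf
  rw [real_inner_smul_left, real_inner_comm h]
  set p := ⟪h, Y.1 - X.1⟫
  set q := qf κ X Y
  have h1 : Real.sqrt (q ^ 2 + (κ ^ 2 - 1) * (‖h‖ ^ 2 - 2 * p))
      ≤ |q + (κ ^ 2 - 1) * (‖h‖ ^ 2 - 2 * p) / (2 * q)| := by
    apply Real.sqrt_le_iff.2 ⟨abs_nonneg _, ?_⟩
    rw [sq_abs]
    have : (q + (κ ^ 2 - 1) * (‖h‖ ^ 2 - 2 * p) / (2 * q)) ^ 2 =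
       q ^ 2 + (κ ^ 2 - 1) * (‖h‖ ^ 2 - 2 * p) + ((κ ^ 2 - 1) * (‖h‖ ^ 2 - 2 * p) / (2 * q)) ^ 2 := by
      field_simp; ring
    rw [this]
    nlinarith [sq_nonneg ((κ ^ 2 - 1) * (‖h‖ ^ 2 - 2 * p) / (2 * q))]
  have h2 : 0 ≤ q + (κ ^ 2 - 1) * (‖h‖ ^ 2 - 2 * p) / (2 * q) := by
    have h3 : 0 ≤ q ^ 2 + (κ ^ 2 - 1) * (‖h‖ ^ 2 - 2 * p) := by
      have := qf_sq κ X Y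
      have h4 : ‖h - (Y.1 - X.1)‖ ^ 2 = ‖h‖ ^ 2 - 2 * p + ‖Y.1 - X.1‖ ^ 2 := norm_sub_sq_real _ _
      have : q ^ 2 + (κ ^ 2 - 1) * (‖h‖ ^ 2 - 2 * p) =
        cfun κ X Y ^ 2 + (κ ^ 2 - 1) * ‖h - (Y.1 - X.1)‖ ^ 2 := by
        rw [h4]; simp only [q]; rw [this]; ring
      rw [this]; positivity
    have : q + (κ ^ 2 - 1) * (‖h‖ ^ 2 - 2 * p) / (2 * q) =
      (q ^ 2 + (q ^ 2 + (κ ^ 2 - 1) * (‖h‖ ^ 2 - 2 * p))) / (2 * q) := by field_simp; ring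
    rw [this]; positivity
  rw [abs_of_nonneg h2] at h1
  set R := Real.sqrt (q ^ 2 + (κ ^ 2 - 1) * (‖h‖ ^ 2 - 2 * p))
  have h5 : (q - (q + (κ ^ 2 - 1) * (‖h‖ ^ 2 - 2 * p) / (2 * q))) / (κ ^ 2 - 1)
    ≤ (q - R) / (κ ^ 2 - 1) := by gcongr
  have e : (q - (q + (κ ^ 2 - 1) * (‖h‖ ^ 2 - 2 * p) / (2 * q))) / (κ ^ 2 - 1)
    = q⁻¹ * p - ‖h‖ ^ 2 / (2 * q) := by field_simp; ring
  linarith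

lemma hypb_lip {n : ℕ} {κ : ℝ} (hκ : 1 < κ) (Y : E n × ℝ) (b : ℝ) (x z : E n) :
    (κ ^ 2 - 1) * (hypb κ Y b x - hypb κ Y b z) ^ 2 ≤ ‖x - z‖ ^ 2 := by
  have hK := Kpos hκ
  rw [hypb_eq hκ, hypb_eq hκ]
  have e1 := Real.sq_sqrt (by positivity : 0 ≤ b ^ 2 + (κ ^ 2 - 1) * ‖x - Y.1‖ ^ 2)
  have e2 := Real.sq_sqrt (by positivity : 0 ≤ b ^ 2 + (κ ^ 2 - 1) * ‖z - Y.1‖ ^ 2)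
  have p1 := Real.sqrt_nonneg (b ^ 2 + (κ ^ 2 - 1) * ‖x - Y.1‖ ^ 2)
  have p2 := Real.sqrt_nonneg (b ^ 2 + (κ ^ 2 - 1) * ‖z - Y.1‖ ^ 2)
  have tri := abs_norm_sub_norm_le (x - Y.1) (z - Y.1)
  rw [sub_sub_sub_cancel_right] at tri
  have tri2 := pow_le_pow_left₀ (abs_nonneg _) tri 2
  rw [sq_abs] at tri2
  have m0 := norm_nonneg (x - Y.1)
  have m1 := norm_nonneg (z - Y.1)
  set S := Real.sqrt (b ^ 2 + (κ ^ 2 - 1) * ‖x - Y.1‖ ^ 2)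
  set R := Real.sqrt (b ^ 2 + (κ ^ 2 - 1) * ‖z - Y.1‖ ^ 2)
  set α := ‖x - Y.1‖
  set β := ‖z - Y.1‖
  have e : (κ ^ 2 - 1) * ((Y.2 - κ * b / (κ ^ 2 - 1) - S / (κ ^ 2 - 1)) -
    (Y.2 - κ * b / (κ ^ 2 - 1) - R / (κ ^ 2 - 1))) ^ 2 = (S - R) ^ 2 / (κ ^ 2 - 1) := by
    field_simp; ring
  rw [e, div_le_iff₀ hK]
  have h6 : b ^ 2 + (κ ^ 2 - 1) * (α * β) ≤ S * R := by
    apply le_of_sq_le_sq0 _ (by positivity)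
    rw [mul_pow, e1, e2]
    nlinarith [mul_nonneg (mul_nonneg (sq_nonneg b) hK.le) (sq_nonneg (α - β))]
  nlinarith

lemma exists_support {n : ℕ} {κ : ℝ} (hκ : 1 < κ) {Ω : Set (E n)} (hΩo : IsOpen Ω)
    {Tgt : Set (E n × ℝ)} (hTc : IsCompact Tgt) {M Δ : ℝ} (hM : ∀ Y ∈ Tgt, Y.2 ≤ M)
    {u : E n → ℝ}
    (hu : ∀ x₀ ∈ Ω, ∃ Y ∈ Tgt, ∃ b : ℝ, 0 < b ∧
      b < κ * Y.2 - Real.sqrt (Y.2 ^ 2 + Δ ^ 2) ∧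
      (∀ x ∈ Ω, hypb κ Y b x ≤ u x) ∧ u x₀ = hypb κ Y b x₀)
    {x₀ : E n} (hx₀ : x₀ ∈ Ω)
    (hgeo : ∀ Y ∈ Tgt, u x₀ < Y.2 ∧ 0 < cfun κ (x₀, u x₀) Y)
    {Y₀ : E n × ℝ} (hY₀ : Y₀ ∈ Tgt) {ε : ℝ} (hε : 0 < ε)
    (hloc : ∀ x ∈ Metric.ball x₀ ε, hyp κ x Y₀ (x₀, u x₀) ≤ u x) (e : E n) :
    ∃ Y ∈ Tgt, (∀ x ∈ Ω, hyp κ x Y (x₀, u x₀) ≤ u x) ∧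
      cfun κ (x₀, u x₀) Y ≤ κ * Y.2 - Real.sqrt (Y.2 ^ 2 + Δ ^ 2) ∧
      ⟪vf κ (x₀, u x₀) Y₀, e⟫ ≤ ⟪vf κ (x₀, u x₀) Y, e⟫ := by
  have hK := Kpos hκ
  obtain ⟨r0, hr0, hball⟩ := Metric.isOpen_iff.1 hΩo x₀ hx₀
  set r := min r0 ε with hr
  have hrpos : 0 < r := lt_min hr0 hε
  have hT : 0 < r / (‖e‖ + 1) := by positivity
  set t : ℕ → ℝ := fun k => r / (‖e‖ + 1) * (1 / ((k : ℝ) + 1)) with ht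
  have htpos : ∀ k, 0 < t k := fun k => by simp only [t]; positivity
  have htlim : Filter.Tendsto t Filter.atTop (nhds 0) := by
    have := (tendsto_one_div_add_atTop_nhds_zero_nat (𝕜 := ℝ)).const_mul (r / (‖e‖ + 1))
    simpa [t] using this
  have hx : ∀ k, x₀ + t k • e ∈ Metric.ball x₀ r := by
    intro k
    rw [mem_ball_iff_norm, add_sub_cancel_left, norm_smul, Real.norm_of_nonneg (htpos k).le]
    have h1 : (1 / ((k : ℝ) + 1)) ≤ 1 := by
      rw [div_le_one (by positivity)]
      have : (0 : ℝ) ≤ k := Nat.cast_nonneg k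
      linarith
    have h2 : t k ≤ r / (‖e‖ + 1) := by
      simp only [t]; nlinarith
    calc t k * ‖e‖ ≤ r / (‖e‖ + 1) * ‖e‖ := by gcongr
      _ < r / (‖e‖ + 1) * (‖e‖ + 1) := by gcongr; linarith
      _ = r := by field_simp
  have hxΩ : ∀ k, x₀ + t k • e ∈ Ω := fun k =>
    hball (Metric.ball_subset_ball (min_le_left _ _) (hx k))
  have hxε : ∀ k, x₀ + t k • e ∈ Metric.ball x₀ ε := fun k =>
    (Metric.ball_subset_ball (min_le_right _ _) (hx k))
  choose Y hYT b hb0 hbΔ hsup heq using fun k => hu _ (hxΩ k)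
  have hcomp : IsCompact (Tgt ×ˢ Set.Icc 0 (κ * M)) := hTc.prod isCompact_Icc
  have hmem : ∀ k, (Y k, b k) ∈ Tgt ×ˢ Set.Icc 0 (κ * M) := by
    intro k
    refine ⟨hYT k, (hb0 k).le, ?_⟩
    have := hM _ (hYT k)
    have h2 := Real.sqrt_nonneg ((Y k).2 ^ 2 + Δ ^ 2)
    have h3 := hbΔ k
    show b k ≤ κ * M
    nlinarith
  obtain ⟨⟨Yi, bi⟩, hZi, ψ, hψ, hlim⟩ := hcomp.tendsto_subseq hmem
  have hlimY : Filter.Tendsto (fun k => Y (ψ k)) Filter.atTop (nhds Yi) :=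
    (continuous_fst.tendsto _).comp hlim
  have hlimb : Filter.Tendsto (fun k => b (ψ k)) Filter.atTop (nhds bi) :=
    (continuous_snd.tendsto _).comp hlim
  have htlim' : Filter.Tendsto (fun k => t (ψ k)) Filter.atTop (nhds 0) :=
    htlim.comp hψ.tendsto_atTop
  have hlimx : Filter.Tendsto (fun k => x₀ + t (ψ k) • e) Filter.atTop (nhds x₀) := by
    have := (htlim'.smul_const e).const_add x₀
    simpa using this
  have hYi : Yi ∈ Tgt := hZi.1
  have hbi : 0 ≤ bi := hZi.2.1
  have hsupi : ∀ x ∈ Ω, hypb κ Yi bi x ≤ u x := by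
    intro x hx
    have h1 : Filter.Tendsto (fun k => hypb κ (Y (ψ k)) (b (ψ k)) x) Filter.atTop
        (nhds (hypb κ Yi bi x)) :=
      ((hypb_continuous κ).tendsto ((Yi, bi), x)).comp (hlim.prodMk_nhds tendsto_const_nhds)
    exact le_of_tendsto' h1 fun k => hsup _ x hx
  have hlow : ∀ k, u x₀ + ⟪vf κ (x₀, u x₀) Y₀, t k • e⟫
      - ‖t k • e‖ ^ 2 / (2 * qf κ (x₀, u x₀) Y₀) ≤ u (x₀ + t k • e) := fun k =>
    (hyp_lower hκ (X := (x₀, u x₀)) (hgeo _ hY₀).1 (t k • e)).trans (hloc _ (hxε k))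
  have heqi : u x₀ = hypb κ Yi bi x₀ := by
    apply le_antisymm _ (hsupi _ hx₀)
    have h1 : Filter.Tendsto (fun k => hypb κ (Y (ψ k)) (b (ψ k)) (x₀ + t (ψ k) • e)) Filter.atTop
        (nhds (hypb κ Yi bi x₀)) :=
      ((hypb_continuous κ).tendsto ((Yi, bi), x₀)).comp (hlim.prodMk_nhds hlimx)
    have h2 : Filter.Tendsto (fun k => u x₀ + ⟪vf κ (x₀, u x₀) Y₀, t (ψ k) • e⟫
      - ‖t (ψ k) • e‖ ^ 2 / (2 * qf κ (x₀, u x₀) Y₀)) Filter.atTop (nhds (u x₀)) := by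
      have hc : Continuous (fun s : ℝ => u x₀ + ⟪vf κ (x₀, u x₀) Y₀, s • e⟫
        - ‖s • e‖ ^ 2 / (2 * qf κ (x₀, u x₀) Y₀)) := by fun_prop
      have := (hc.tendsto 0).comp htlim'
      simpa [Function.comp_def] using this
    exact le_of_tendsto_of_tendsto' h2 h1 fun k => (hlow _).trans (heq _).le
  have hbc : bi = cfun κ (x₀, u x₀) Yi := b_eq_cfun hκ hbi heqi
  refine ⟨Yi, hYi, ?_, ?_, ?_⟩
  · intro x hx
    unfold hyp
    rw [← hbc]
    exact hsupi x hx
  · rw [← hbc]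
    have h1 : Filter.Tendsto (fun k => κ * (Y (ψ k)).2 - Real.sqrt ((Y (ψ k)).2 ^ 2 + Δ ^ 2))
        Filter.atTop (nhds (κ * Yi.2 - Real.sqrt (Yi.2 ^ 2 + Δ ^ 2))) := by
      have hc : Continuous (fun Y : E n × ℝ => κ * Y.2 - Real.sqrt (Y.2 ^ 2 + Δ ^ 2)) := by fun_prop
      exact (hc.tendsto Yi).comp hlimY
    exact le_of_tendsto_of_tendsto' hlimb h1 fun k => (hbΔ _).le
  · have hqi := qf_pos (X := (x₀, u x₀)) hκ (hgeo _ hYi).1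
    have hq0 := qf_pos (X := (x₀, u x₀)) hκ (hgeo _ hY₀).1
    have hSi : Real.sqrt (bi ^ 2 + (κ ^ 2 - 1) * ‖x₀ - Yi.1‖ ^ 2) = qf κ (x₀, u x₀) Yi := by
      rw [hbc, norm_sub_rev, ← Real.sqrt_sq hqi.le, qf_sq κ (x₀, u x₀) Yi]
    have h1 : Filter.Tendsto (fun k => ⟪(Y (ψ k)).1 - x₀, e⟫ /
        Real.sqrt (b (ψ k) ^ 2 + (κ ^ 2 - 1) * ‖x₀ - (Y (ψ k)).1‖ ^ 2)) Filter.atTop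
        (nhds (⟪Yi.1 - x₀, e⟫ / Real.sqrt (bi ^ 2 + (κ ^ 2 - 1) * ‖x₀ - Yi.1‖ ^ 2))) := by
      apply Filter.Tendsto.div
      · have hc : Continuous (fun Y : E n × ℝ => ⟪Y.1 - x₀, e⟫) := by fun_prop
        exact (hc.tendsto Yi).comp hlimY
      · have hc : Continuous (fun Z : (E n × ℝ) × ℝ =>
          Real.sqrt (Z.2 ^ 2 + (κ ^ 2 - 1) * ‖x₀ - Z.1.1‖ ^ 2)) := by fun_prop
        exact (hc.tendsto (Yi, bi)).comp hlim
      · rw [hSi]; exact hqi.ne'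
    have h2 : Filter.Tendsto (fun k => ⟪vf κ (x₀, u x₀) Y₀, e⟫
      - t (ψ k) * (‖e‖ ^ 2 / (2 * qf κ (x₀, u x₀) Y₀))) Filter.atTop
      (nhds ⟪vf κ (x₀, u x₀) Y₀, e⟫) := by
      have := (htlim'.mul_const (‖e‖ ^ 2 / (2 * qf κ (x₀, u x₀) Y₀))).const_sub
        ⟪vf κ (x₀, u x₀) Y₀, e⟫
      simpa using this
    have h3 := le_of_tendsto_of_tendsto' h2 h1 (fun k => by
      have a1 := hlow (ψ k)
      rw [heq] at a1
      have a2 := hypb_concave hκ (hb0 (ψ k)) (Y (ψ k)) x₀ (t (ψ k) • e)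
      have a3 := hsup (ψ k) x₀ hx₀
      rw [real_inner_smul_right] at a1 a2
      rw [norm_smul, Real.norm_of_nonneg (htpos _).le] at a1
      have a4 := htpos (ψ k)
      apply le_of_mul_le_mul_left _ a4
      rw [mul_div_assoc] at a2
      have a5 : t (ψ k) * (⟪vf κ (x₀, u x₀) Y₀, e⟫ - t (ψ k) * (‖e‖ ^ 2 / (2 * qf κ (x₀, u x₀) Y₀)))
        = t (ψ k) * ⟪vf κ (x₀, u x₀) Y₀, e⟫ - (t (ψ k) * ‖e‖) ^ 2 / (2 * qf κ (x₀, u x₀) Y₀) := by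
        ring
      linarith)
    rw [hSi] at h3
    refine h3.trans (le_of_eq ?_)
    unfold vf
    rw [real_inner_smul_left, div_eq_inv_mul]

lemma hasFDerivAt_N {n : ℕ} (A K : ℝ) (y x : E n) :
    HasFDerivAt (fun z : E n => A + ‖z - y‖ ^ 2 / K) ((2 / K) • innerSL ℝ (x - y)) x := by
  have h1 : HasFDerivAt (fun z : E n => z - y) (ContinuousLinearMap.id ℝ (E n)) x :=
    (hasFDerivAt_id x).sub_const y
  have h2 := ((h1.norm_sq).const_mul K⁻¹).const_add A
  have e : (fun z : E n => A + ‖z - y‖ ^ 2 / K) = fun z => A + K⁻¹ * ‖z - y‖ ^ 2 := by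
    funext z; rw [div_eq_inv_mul]
  rw [e]
  refine h2.congr_fderiv ?_
  refine ContinuousLinearMap.ext fun w => ?_
  simp
  ring

lemma hasFDerivAt_I {n : ℕ} (K : ℝ) (y x η : E n) :
    HasFDerivAt (fun z : E n => -(⟪z - y, η⟫ / K)) (-((1 / K) • innerSL ℝ η)) x := by
  have h1 : HasFDerivAt (fun z : E n => z - y) (ContinuousLinearMap.id ℝ (E n)) x :=
    (hasFDerivAt_id x).sub_const y
  have h2 := (((innerSL ℝ η).hasFDerivAt.comp x h1).const_mul K⁻¹).neg
  have e : (fun z : E n => -(⟪z - y, η⟫ / K)) =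
      -fun w => K⁻¹ * (⇑((innerSL ℝ) η) ∘ fun z => z - y) w := by
    funext z
    simp only [Function.comp_apply, innerSL_apply_apply, Pi.neg_apply]
    rw [div_eq_inv_mul, real_inner_comm η]
  rw [e]
  refine h2.congr_fderiv ?_
  refine ContinuousLinearMap.ext fun w => ?_
  simp

lemma hypb_hasFDerivAt {n : ℕ} {κ b : ℝ} (hκ : 1 < κ) (hb : 0 < b) (Y : E n × ℝ) (z η : E n) :
    fderiv ℝ (hypb κ Y b) z η = - (⟪z - Y.1, η⟫ / (κ ^ 2 - 1)) *
      (Real.sqrt (b ^ 2 / (κ ^ 2 - 1) ^ 2 + ‖z - Y.1‖ ^ 2 / (κ ^ 2 - 1)))⁻¹ := by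
  have hK := Kpos hκ
  have hA : b ^ 2 / (κ ^ 2 - 1) ^ 2 + ‖z - Y.1‖ ^ 2 / (κ ^ 2 - 1) ≠ 0 := by positivity
  have h2 := (hasFDerivAt_N (b ^ 2 / (κ ^ 2 - 1) ^ 2) (κ ^ 2 - 1) Y.1 z).sqrt hA
  have h3 := h2.const_sub (Y.2 - κ * b / (κ ^ 2 - 1))
  have h4 : fderiv ℝ (hypb κ Y b) z = _ := h3.fderiv
  rw [h4]
  simp only [_root_.neg_apply, _root_.smul_apply, innerSL_apply_apply,
    smul_eq_mul]
  field_simp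

lemma hess_hypb {n : ℕ} {κ b : ℝ} (hκ : 1 < κ) (hb : 0 < b) (Y : E n × ℝ) (x₀ η : E n) {S : ℝ}
    (hS : Real.sqrt (b ^ 2 / (κ ^ 2 - 1) ^ 2 + ‖x₀ - Y.1‖ ^ 2 / (κ ^ 2 - 1)) = S) :
    hess (hypb κ Y b) x₀ η η = - (‖η‖ ^ 2 / (κ ^ 2 - 1)) * S⁻¹
      + (⟪x₀ - Y.1, η⟫ / (κ ^ 2 - 1)) ^ 2 * (S ^ 3)⁻¹ := by
  have hK := Kpos hκ
  unfold hess
  have e : (fun z => fderiv ℝ (hypb κ Y b) z η) = fun z => - (⟪z - Y.1, η⟫ / (κ ^ 2 - 1)) *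
      (Real.sqrt (b ^ 2 / (κ ^ 2 - 1) ^ 2 + ‖z - Y.1‖ ^ 2 / (κ ^ 2 - 1)))⁻¹ := by
    ext z; exact hypb_hasFDerivAt hκ hb Y z η
  rw [e]
  have hA : 0 < b ^ 2 / (κ ^ 2 - 1) ^ 2 + ‖x₀ - Y.1‖ ^ 2 / (κ ^ 2 - 1) := by positivity
  have hSp : 0 < S := hS ▸ Real.sqrt_pos.2 hA
  have h2 := (hasFDerivAt_N (b ^ 2 / (κ ^ 2 - 1) ^ 2) (κ ^ 2 - 1) Y.1 x₀).sqrt hA.ne'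
  have h3 := (hasDerivAt_inv (x := Real.sqrt (b ^ 2 / (κ ^ 2 - 1) ^ 2 + ‖x₀ - Y.1‖ ^ 2 / (κ ^ 2 - 1)))
    (by rw [hS]; exact hSp.ne')).comp_hasFDerivAt x₀ h2
  have h4 := (hasFDerivAt_I (κ ^ 2 - 1) Y.1 x₀ η).mul h3
  have h5 := h4.fderiv
  have h6 : fderiv ℝ (fun z => - (⟪z - Y.1, η⟫ / (κ ^ 2 - 1)) *
      (Real.sqrt (b ^ 2 / (κ ^ 2 - 1) ^ 2 + ‖z - Y.1‖ ^ 2 / (κ ^ 2 - 1)))⁻¹) x₀ = _ := h5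
  rw [h6]
  simp only [Function.comp_apply, _root_.add_apply, _root_.neg_apply,
    _root_.smul_apply, innerSL_apply_apply, smul_eq_mul, hS,
    real_inner_self_eq_norm_sq]
  field_simp
  ring

def gf {n : ℕ} (κ : ℝ) (sfun : (E n × ℝ) → (E n × ℝ) → ℝ) (X : E n × ℝ) (v : E n) : ℝ :=
  (qf κ X (YofZ κ sfun X v))⁻¹

lemma hess_YofZ {n : ℕ} {κ : ℝ} (hκ : 1 < κ) {sfun : (E n × ℝ) → (E n × ℝ) → ℝ}
    {X : E n × ℝ} {v : E n} (hv : (κ ^ 2 - 1) * ‖v‖ ^ 2 < 1) (hs : 0 < sfun X (Λf κ v)) (η : E n) :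
    hess (fun z => hyp κ z (YofZ κ sfun X v) X) X.1 η η =
      - (gf κ sfun X v * (‖η‖ ^ 2 - (κ ^ 2 - 1) * ⟪v, η⟫ ^ 2)) := by
  have hK := Kpos hκ
  obtain ⟨hT, hc, hq, h1, h2⟩ := YofZ_facts hκ hv hs
  unfold gf
  set Y := YofZ κ sfun X v
  have hqp := qf_pos hκ hT
  have hsq := qf_sq κ X Y
  have hS : Real.sqrt (cfun κ X Y ^ 2 / (κ ^ 2 - 1) ^ 2 + ‖X.1 - Y.1‖ ^ 2 / (κ ^ 2 - 1))
      = qf κ X Y / (κ ^ 2 - 1) := by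
    rw [norm_sub_rev, ← Real.sqrt_sq (by positivity : 0 ≤ qf κ X Y / (κ ^ 2 - 1))]
    congr 1
    rw [div_pow, hsq]
    field_simp
  have := hess_hypb hκ hc Y X.1 η hS
  have e : (fun z => hyp κ z Y X) = hypb κ Y (cfun κ X Y) := rfl
  rw [e, this, ← neg_sub Y.1, inner_neg_left, h1, real_inner_smul_left]
  field_simp
  ring

lemma ball_open {n : ℕ} (κ : ℝ) : IsOpen {v : E n | (κ ^ 2 - 1) * ‖v‖ ^ 2 < 1} :=
  isOpen_lt (by fun_prop) continuous_const

lemma cball_convex {n : ℕ} {κ : ℝ} (hκ : 1 < κ) {m : ℝ} :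
    Convex ℝ {v : E n | (κ ^ 2 - 1) * ‖v‖ ^ 2 ≤ m} := by
  have : ConvexOn ℝ Set.univ (fun v : E n => (κ ^ 2 - 1) * ‖v‖ ^ 2) := by
    have h1 : ConvexOn ℝ Set.univ (fun v : E n => ‖v‖ ^ 2) :=
      (convexOn_norm convex_univ).pow (fun x _ => norm_nonneg x) 2
    exact h1.smul (Kpos hκ).le
  simpa using this.convex_le m

lemma gf_contDiffOn {n : ℕ} {κ : ℝ} (hκ : 1 < κ) {sfun : (E n × ℝ) → (E n × ℝ) → ℝ}
    {X : E n × ℝ} (hs : ∀ d, 0 < sfun X d)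
    (hC2 : ContDiffOn ℝ 2 (fun v : E n => YofZ κ sfun X v)
      {v : E n | (κ ^ 2 - 1) * ‖v‖ ^ 2 < 1}) :
    ContDiffOn ℝ 2 (gf κ sfun X) {v : E n | (κ ^ 2 - 1) * ‖v‖ ^ 2 < 1} := by
  have hQ : ContDiffOn ℝ 2 (fun v : E n => Qf κ v) {v : E n | (κ ^ 2 - 1) * ‖v‖ ^ 2 < 1} := by
    unfold Qf
    have hn : ContDiffOn ℝ 2 (fun v : E n => ‖v‖ ^ 2) {v : E n | (κ ^ 2 - 1) * ‖v‖ ^ 2 < 1} :=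
      (contDiff_norm_sq ℝ).contDiffOn
    refine ContDiffOn.div (contDiffOn_const.sub (ContDiffOn.sqrt
      (contDiffOn_const.sub (contDiffOn_const.mul hn)) ?_)) (contDiffOn_const.add hn) ?_
    · intro v hv
      have : (κ ^ 2 - 1) * ‖v‖ ^ 2 < 1 := hv
      exact (by linarith : 0 < 1 - (κ ^ 2 - 1) * ‖v‖ ^ 2).ne'
    · intro v hv
      positivity
  have hT : ContDiffOn ℝ 2 (fun v : E n => (YofZ κ sfun X v).2 - X.2)
      {v : E n | (κ ^ 2 - 1) * ‖v‖ ^ 2 < 1} := (contDiff_snd.comp_contDiffOn hC2).sub contDiffOn_const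
  have hpos : ∀ v : E n, (κ ^ 2 - 1) * ‖v‖ ^ 2 < 1 → 0 < κ - Qf κ v := fun v hv => by
    nlinarith [Qf_lt hκ hv]
  have h1 : ContDiffOn ℝ 2 (fun v : E n => (((YofZ κ sfun X v).2 - X.2) / (κ - Qf κ v) * Qf κ v)⁻¹)
      {v : E n | (κ ^ 2 - 1) * ‖v‖ ^ 2 < 1} := by
    refine ContDiffOn.inv ((hT.div (contDiffOn_const.sub hQ) ?_).mul hQ) ?_
    · intro v hv
      exact (hpos v hv).ne'
    · intro v hv
      obtain ⟨a, _, _, _, d⟩ := YofZ_facts hκ hv (hs _)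
      have := hpos v hv
      have := Qf_pos hκ hv
      have : 0 < (YofZ κ sfun X v).2 - X.2 := by linarith
      positivity
  refine h1.congr fun v hv => ?_
  obtain ⟨_, _, hq, _, d⟩ := YofZ_facts hκ hv (hs _)
  unfold gf
  rw [hq, d]
  have := hpos v hv
  congr 1
  field_simp

lemma exists_perp {n : ℕ} (hn : 2 ≤ n) (ξ : E n) : ∃ η : E n, ⟪ξ, η⟫ = 0 ∧ η ≠ 0 := by
  have : Module.finrank ℝ (ℝ ∙ ξ) < Module.finrank ℝ (E n) := by
    have h1 := finrank_span_le_card (R := ℝ) ({ξ} : Set (E n))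
    rw [Set.toFinset_card, Fintype.card_unique] at h1
    have h2 : Module.finrank ℝ (E n) = n := finrank_euclideanSpace_fin
    omega
  have h3 : (ℝ ∙ ξ)ᗮ ≠ ⊥ := by
    intro h
    rw [Submodule.orthogonal_eq_bot_iff] at h
    rw [h, finrank_top] at this
    exact lt_irrefl _ this
  obtain ⟨η, hη, h0⟩ := Submodule.exists_mem_ne_zero_of_ne_bot h3
  exact ⟨η, Submodule.mem_orthogonal_singleton_iff_inner_right.1 hη, h0⟩

lemma gf_concave {n : ℕ} (hn : 2 ≤ n) {κ : ℝ} (hκ : 1 < κ) {sfun : (E n × ℝ) → (E n × ℝ) → ℝ}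
    {X : E n × ℝ} (hs : ∀ d, 0 < sfun X d)
    (hC2 : ContDiffOn ℝ 2 (fun v : E n => YofZ κ sfun X v)
      {v : E n | (κ ^ 2 - 1) * ‖v‖ ^ 2 < 1})
    (hAW : ∀ v : E n, (κ ^ 2 - 1) * ‖v‖ ^ 2 < 1 → ∀ ξ η : E n, ⟪ξ, η⟫ = 0 →
      0 ≤ fderiv ℝ (fun w : E n => fderiv ℝ
            (fun v' : E n =>
              hess (fun z => hyp κ z (YofZ κ sfun X v') X) X.1 η η)
            w ξ) v ξ) {m : ℝ} (hm : m < 1) :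
    ConcaveOn ℝ {v : E n | (κ ^ 2 - 1) * ‖v‖ ^ 2 ≤ m} (gf κ sfun X) := by
  have hK := Kpos hκ
  have hg := gf_contDiffOn hκ hs hC2
  have hBo := ball_open (n := n) κ
  refine ⟨cball_convex hκ, fun a ha b hb α β hα hβ hαβ => ?_⟩
  obtain ⟨η, hη, hη0⟩ := exists_perp hn (b - a)
  set F : E n → ℝ := fun v => - (gf κ sfun X v * (‖η‖ ^ 2 - (κ ^ 2 - 1) * ⟪v, η⟫ ^ 2)) with hF
  have hFc : ContDiffOn ℝ 2 F {v : E n | (κ ^ 2 - 1) * ‖v‖ ^ 2 < 1} := by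
    refine (hg.mul (ContDiff.contDiffOn ?_)).neg
    exact contDiff_const.sub (contDiff_const.mul ((contDiff_id.inner ℝ contDiff_const).pow 2))
  have hseg : ∀ r ∈ Set.Icc (0 : ℝ) 1, (κ ^ 2 - 1) * ‖a + r • (b - a)‖ ^ 2 < 1 := by
    intro r hr
    have : a + r • (b - a) ∈ {v : E n | (κ ^ 2 - 1) * ‖v‖ ^ 2 ≤ m} :=
      (cball_convex hκ).add_smul_sub_mem ha hb hr
    exact lt_of_le_of_lt this hm
  have hline : ∀ r : ℝ, HasDerivAt (fun r : ℝ => a + r • (b - a)) (b - a) r := by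
    intro r
    simpa using ((hasDerivAt_id r).smul_const (b - a)).const_add a
  have hD1 : ∀ v : E n, (κ ^ 2 - 1) * ‖v‖ ^ 2 < 1 → DifferentiableAt ℝ F v := fun v hv =>
    ((hFc.contDiffAt (hBo.mem_nhds hv)).differentiableAt (by norm_num))
  have hD2 : ∀ v : E n, (κ ^ 2 - 1) * ‖v‖ ^ 2 < 1 →
      DifferentiableAt ℝ (fun w => fderiv ℝ F w (b - a)) v := fun v hv => by
    have h1 : ContDiffAt ℝ 1 (fderiv ℝ F) v :=
      (hFc.contDiffAt (hBo.mem_nhds hv)).fderiv_right (by norm_num)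
    exact (h1.differentiableAt (by norm_num)).clm_apply (differentiableAt_const _)
  have hAW' : ∀ v : E n, (κ ^ 2 - 1) * ‖v‖ ^ 2 < 1 →
      0 ≤ fderiv ℝ (fun w => fderiv ℝ F w (b - a)) v (b - a) := by
    intro v hv
    have h1 := hAW v hv (b - a) η hη
    have h2 : ∀ w : E n, (κ ^ 2 - 1) * ‖w‖ ^ 2 < 1 →
        (fun v' : E n => hess (fun z => hyp κ z (YofZ κ sfun X v') X) X.1 η η) =ᶠ[nhds w] F := by
      intro w hw
      filter_upwards [hBo.mem_nhds hw] with v' hv'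
      exact hess_YofZ hκ hv' (hs _) η
    have h3 : (fun w : E n => fderiv ℝ (fun v' : E n =>
              hess (fun z => hyp κ z (YofZ κ sfun X v') X) X.1 η η) w (b - a)) =ᶠ[nhds v]
          (fun w => fderiv ℝ F w (b - a)) := by
      filter_upwards [hBo.mem_nhds hv] with w hw
      rw [(h2 w hw).fderiv_eq]
    rwa [h3.fderiv_eq] at h1
  have hconv : ConvexOn ℝ (Set.Icc (0 : ℝ) 1) (fun r => F (a + r • (b - a))) := by
    have hd : ∀ r ∈ Set.Icc (0 : ℝ) 1, HasDerivAt (fun r => F (a + r • (b - a)))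
        (fderiv ℝ F (a + r • (b - a)) (b - a)) r := fun r hr =>
      HasFDerivAt.comp_hasDerivAt (f := fun r : ℝ => a + r • (b - a)) r
        (hD1 _ (hseg r hr)).hasFDerivAt (hline r)
    have hd2 : ∀ r ∈ Set.Icc (0 : ℝ) 1,
        HasDerivAt (fun r : ℝ => fderiv ℝ F (a + r • (b - a)) (b - a))
        (fderiv ℝ (fun w => fderiv ℝ F w (b - a)) (a + r • (b - a)) (b - a)) r := fun r hr =>
      HasFDerivAt.comp_hasDerivAt (f := fun r : ℝ => a + r • (b - a)) r
        (hD2 _ (hseg r hr)).hasFDerivAt (hline r)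
    refine convexOn_of_hasDerivWithinAt2_nonneg (convex_Icc 0 1)
      (fun r hr => (hd r hr).continuousAt.continuousWithinAt)
      (fun r hr => (hd r (interior_subset hr)).hasDerivWithinAt)
      (fun r hr => (hd2 r (interior_subset hr)).hasDerivWithinAt)
      (fun r hr => hAW' _ (hseg r (interior_subset hr)))
  have key := hconv.2 (x := 0) (by simp) (y := 1) (by simp) hα hβ hαβ
  have e1 : a + (α • (0 : ℝ) + β • (1 : ℝ)) • (b - a) = α • a + β • b := by
    have : α = 1 - β := by linarith
    subst this
    simp only [smul_eq_mul, mul_zero, mul_one, zero_add, smul_sub, sub_smul, one_smul]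
    abel
  have e2 : ⟪b, η⟫ = ⟪a, η⟫ := by
    rw [inner_sub_left] at hη; linarith
  have e3 : ⟪α • a + β • b, η⟫ = ⟪a, η⟫ := by
    rw [inner_add_left, real_inner_smul_left, real_inner_smul_left, e2, ← add_mul, hαβ, one_mul]
  simp only [e1] at key
  simp only [zero_smul, add_zero, one_smul, add_sub_cancel, hF, e2, e3, smul_eq_mul] at key
  have hC : 0 < ‖η‖ ^ 2 - (κ ^ 2 - 1) * ⟪a, η⟫ ^ 2 := by
    have hcs := real_inner_mul_inner_self_le a η
    rw [real_inner_self_eq_norm_sq, real_inner_self_eq_norm_sq] at hcs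
    have ha' : (κ ^ 2 - 1) * ‖a‖ ^ 2 < 1 := lt_of_le_of_lt ha hm
    have hη2 : 0 < ‖η‖ ^ 2 := by positivity
    nlinarith
  set C := ‖η‖ ^ 2 - (κ ^ 2 - 1) * ⟪a, η⟫ ^ 2
  simp only [smul_eq_mul]
  apply le_of_mul_le_mul_right _ hC
  linarith

lemma qf_continuous {n : ℕ} (κ : ℝ) (X : E n × ℝ) : Continuous (fun Y : E n × ℝ => qf κ X Y) := by
  unfold qf pnorm
  simp only [Prod.fst_sub, Prod.snd_sub]
  fun_prop

lemma exists_m {n : ℕ} {κ : ℝ} (hκ : 1 < κ) {Tgt : Set (E n × ℝ)} (hTc : IsCompact Tgt)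
    {X : E n × ℝ} (hgeo : ∀ Y ∈ Tgt, X.2 < Y.2 ∧ 0 < cfun κ X Y) :
    ∃ m < 1, ∀ Y ∈ Tgt, (κ ^ 2 - 1) * ‖vf κ X Y‖ ^ 2 ≤ m := by
  rcases Tgt.eq_empty_or_nonempty with he | hne
  · exact ⟨0, by norm_num, by simp [he]⟩
  have hc : ContinuousOn (fun Y => (κ ^ 2 - 1) * ‖vf κ X Y‖ ^ 2) Tgt := by
    have : ContinuousOn (fun Y => vf κ X Y) Tgt := by
      unfold vf
      refine ContinuousOn.smul (ContinuousOn.inv₀ (qf_continuous κ X).continuousOn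
        (fun Y hY => (qf_pos hκ (hgeo Y hY).1).ne')) (by fun_prop)
    fun_prop
  obtain ⟨Y, hY, hmax⟩ := hTc.exists_isMaxOn hne hc
  exact ⟨_, vf_ball hκ (hgeo Y hY).1 (hgeo Y hY).2, fun Z hZ => hmax hZ⟩

lemma u_lip {n : ℕ} {κ Δ : ℝ} (hκ : 1 < κ) {Ω : Set (E n)} {Tgt : Set (E n × ℝ)}
    {u : E n → ℝ}
    (hu : ∀ x₀ ∈ Ω, ∃ Y ∈ Tgt, ∃ b : ℝ, 0 < b ∧
      b < κ * Y.2 - Real.sqrt (Y.2 ^ 2 + Δ ^ 2) ∧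
      (∀ x ∈ Ω, hypb κ Y b x ≤ u x) ∧ u x₀ = hypb κ Y b x₀) {x z : E n}
    (hx : x ∈ Ω) (hz : z ∈ Ω) : (κ ^ 2 - 1) * (u x - u z) ^ 2 ≤ ‖x - z‖ ^ 2 := by
  have hK := Kpos hκ
  rcases le_total (u z) (u x) with h | h
  · obtain ⟨Y, -, b, -, -, h1, h2⟩ := hu x hx
    refine le_trans ?_ (hypb_lip hκ Y b x z)
    have := h1 z hz
    refine mul_le_mul_of_nonneg_left ?_ hK.le
    apply pow_le_pow_left₀ <;> linarith
  · obtain ⟨Y, -, b, -, -, h1, h2⟩ := hu z hz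
    have h3 := hypb_lip hκ Y b z x
    rw [norm_sub_rev x z]
    refine le_trans ?_ h3
    have := h1 x hx
    refine mul_le_mul_of_nonneg_left ?_ hK.le
    rw [← neg_sq, neg_sub]
    apply pow_le_pow_left₀ <;> linarith

lemma hyp_le_iff' {n : ℕ} {κ : ℝ} (hκ : 1 < κ) {Y X : E n × ℝ} (h : X.2 < Y.2)
    (x : E n) (t : ℝ) (ht : (κ ^ 2 - 1) * t ^ 2 ≤ ‖x - X.1‖ ^ 2) :
    hyp κ x Y X ≤ X.2 + t ↔ 2 * ⟪x - X.1, vf κ X Y⟫ ≤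
      2 * t + (qf κ X Y)⁻¹ * (‖x - X.1‖ ^ 2 - (κ ^ 2 - 1) * t ^ 2) := by
  have hq := qf_pos hκ h
  rw [hyp_le_iff hκ h (by rw [qf_sq]; nlinarith [sq_nonneg (cfun κ X Y)]) x t ht]
  unfold vf
  rw [real_inner_smul_right, ← mul_le_mul_iff_right₀ (inv_pos.2 hq)]
  have e : (qf κ X Y)⁻¹ * (2 * t * qf κ X Y + (‖x - X.1‖ ^ 2 - (κ ^ 2 - 1) * t ^ 2)) =
      2 * t + (qf κ X Y)⁻¹ * (‖x - X.1‖ ^ 2 - (κ ^ 2 - 1) * t ^ 2) := by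
    field_simp
  rw [e]
  ring_nf

lemma case_two {n : ℕ} (hn : 2 ≤ n) {κ Δ M : ℝ} (hκ : 1 < κ) {Ω : Set (E n)} (hΩo : IsOpen Ω)
    {Tgt : Set (E n × ℝ)} (hTc : IsCompact Tgt) (hM : ∀ Y ∈ Tgt, Y.2 ≤ M)
    {u : E n → ℝ}
    (hu : ∀ x₀ ∈ Ω, ∃ Y ∈ Tgt, ∃ b : ℝ, 0 < b ∧
      b < κ * Y.2 - Real.sqrt (Y.2 ^ 2 + Δ ^ 2) ∧
      (∀ x ∈ Ω, hypb κ Y b x ≤ u x) ∧ u x₀ = hypb κ Y b x₀)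
    {sfun : (E n × ℝ) → (E n × ℝ) → ℝ} (hspos : ∀ X d, 0 < sfun X d)
    {x₀ : E n} (hx₀ : x₀ ∈ Ω)
    (hgeo : ∀ Y ∈ Tgt, u x₀ < Y.2 ∧ 0 < cfun κ (x₀, u x₀) Y)
    (hparam : ∀ Y ∈ Tgt,
      ∃ d : E n × ℝ, pnorm d = 1 ∧ Y = (x₀, u x₀) + sfun (x₀, u x₀) d • d)
    (hC2 : ContDiffOn ℝ 2 (fun v : E n => YofZ κ sfun (x₀, u x₀) v)
      {v : E n | (κ ^ 2 - 1) * ‖v‖ ^ 2 < 1})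
    (hAW : ∀ v : E n, (κ ^ 2 - 1) * ‖v‖ ^ 2 < 1 → ∀ ξ η : E n, ⟪ξ, η⟫ = 0 →
      0 ≤ fderiv ℝ (fun w : E n => fderiv ℝ
            (fun v' : E n =>
              hess (fun z => hyp κ z (YofZ κ sfun (x₀, u x₀) v') (x₀, u x₀)) x₀ η η)
            w ξ) v ξ)
    {Y₀ : E n × ℝ} (hY₀ : Y₀ ∈ Tgt) {ε : ℝ} (hε : 0 < ε)
    (hloc : ∀ x ∈ Metric.ball x₀ ε, hyp κ x Y₀ (x₀, u x₀) ≤ u x) :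
    ∀ x ∈ Ω, hyp κ x Y₀ (x₀, u x₀) ≤ u x := by
  obtain ⟨m, hm, hmY⟩ := exists_m hκ hTc (X := (x₀, u x₀)) hgeo
  have hconc := gf_concave hn hκ (hspos (x₀, u x₀)) hC2 hAW hm
  have hcont : ContinuousOn (gf κ sfun (x₀, u x₀)) {v : E n | (κ ^ 2 - 1) * ‖v‖ ^ 2 ≤ m} :=
    (gf_contDiffOn hκ (hspos (x₀, u x₀)) hC2).continuousOn.mono
      (fun v hv => lt_of_le_of_lt hv hm)
  have hBc : IsClosed {v : E n | (κ ^ 2 - 1) * ‖v‖ ^ 2 ≤ m} :=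
    isClosed_le (by fun_prop) continuous_const
  have hgv : ∀ Y ∈ Tgt, gf κ sfun (x₀, u x₀) (vf κ (x₀, u x₀) Y) = (qf κ (x₀, u x₀) Y)⁻¹ := by
    intro Y hY
    obtain ⟨d, hd, h⟩ := hparam Y hY
    unfold gf
    rw [YofZ_vf hκ (hgeo Y hY).1 (hgeo Y hY).2 (hspos _ d) hd h]
  set S : E n → Set (E n) := fun x => {v | v ∈ {v : E n | (κ ^ 2 - 1) * ‖v‖ ^ 2 ≤ m} ∧
    2 * ⟪x - x₀, v⟫ - gf κ sfun (x₀, u x₀) v * (‖x - x₀‖ ^ 2 - (κ ^ 2 - 1) * (u x - u x₀) ^ 2) ≤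
      2 * (u x - u x₀)} with hS
  have hSclosed : ∀ x, IsClosed (S x) := by
    intro x
    have hcc : ContinuousOn (fun v => 2 * ⟪x - x₀, v⟫ - gf κ sfun (x₀, u x₀) v *
      (‖x - x₀‖ ^ 2 - (κ ^ 2 - 1) * (u x - u x₀) ^ 2)) {v : E n | (κ ^ 2 - 1) * ‖v‖ ^ 2 ≤ m} :=
      ContinuousOn.sub (by fun_prop) (hcont.mul continuousOn_const)
    exact hcc.preimage_isClosed_of_isClosed hBc isClosed_Iic
  have hSconv : ∀ x ∈ Ω, Convex ℝ (S x) := by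
    intro x hx
    have hl := u_lip hκ hu hx hx₀
    have h1 : ConvexOn ℝ {v : E n | (κ ^ 2 - 1) * ‖v‖ ^ 2 ≤ m} (fun v => 2 * ⟪x - x₀, v⟫ -
        gf κ sfun (x₀, u x₀) v * (‖x - x₀‖ ^ 2 - (κ ^ 2 - 1) * (u x - u x₀) ^ 2)) := by
      refine ⟨hconc.1, fun a ha b hb α β hα hβ hαβ => ?_⟩
      have h2 := hconc.2 ha hb hα hβ hαβ
      simp only [smul_eq_mul] at h2 ⊢
      rw [inner_add_right, real_inner_smul_right, real_inner_smul_right]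
      nlinarith [mul_le_mul_of_nonneg_right h2 (sub_nonneg.2 hl)]
    exact h1.convex_le _
  have hmem : ∀ Y ∈ Tgt, ∀ x ∈ Ω,
      (vf κ (x₀, u x₀) Y ∈ S x ↔ hyp κ x Y (x₀, u x₀) ≤ u x) := by
    intro Y hY x hx
    have hl := u_lip hκ hu hx hx₀
    have h1 := hyp_le_iff' hκ (X := (x₀, u x₀)) (hgeo Y hY).1 x (u x - u x₀) hl
    rw [show u x₀ + (u x - u x₀) = u x by ring] at h1
    rw [h1]
    simp only [hS, Set.mem_ofPred_eq, hgv Y hY]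
    constructor
    · rintro ⟨-, h⟩
      linarith
    · intro h
      exact ⟨hmY Y hY, by linarith⟩
  intro x hx
  rw [← hmem Y₀ hY₀ x hx]
  by_contra hcon
  have hcl : IsClosed (⋂ x ∈ Ω, S x) := isClosed_biInter fun x _ => hSclosed x
  have hcv : Convex ℝ (⋂ x ∈ Ω, S x) := convex_iInter₂ fun x hx => hSconv x hx
  have hno : vf κ (x₀, u x₀) Y₀ ∉ (⋂ x ∈ Ω, S x) := fun h => hcon (Set.mem_iInter₂.1 h x hx)
  obtain ⟨f, w, hf1, hf2⟩ := geometric_hahn_banach_closed_point hcv hcl hno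
  obtain ⟨Y, hY, hsup, -, hin⟩ := exists_support hκ hΩo hTc hM hu hx₀ hgeo hY₀ hε hloc
    ((InnerProductSpace.toDual ℝ (E n)).symm f)
  rw [real_inner_comm, InnerProductSpace.toDual_symm_apply, real_inner_comm,
    InnerProductSpace.toDual_symm_apply] at hin
  have := hf1 (vf κ (x₀, u x₀) Y) (Set.mem_iInter₂.2 fun z hz => (hmem Y hY z hz).2 (hsup z hz))
  linarith

lemma cross_aux {κ h t y0 T0 ρ0 y2 T2 ρ2 μ : ℝ} (hρ0 : ρ0 ^ 2 = y0 ^ 2 + T0 ^ 2) (p0 : 0 ≤ ρ0)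
    (hρ2 : ρ2 ^ 2 = y2 ^ 2 + T2 ^ 2) (p2 : 0 ≤ ρ2) (hW : κ ^ 2 * t ^ 2 < h ^ 2 + t ^ 2)
    (e0 : y0 * h + T0 * t = κ * t * ρ0 + μ) (e2 : y2 * h + T2 * t = κ * t * ρ2 + μ)
    (hμ : 0 ≤ μ) (hβ0 : 0 < h * T0 - t * y0) (hβ : h * T0 - t * y0 ≤ h * T2 - t * y2) :
    (y2 * h + T2 * t) * (h * T0 - t * y0) ≤ (y0 * h + T0 * t) * (h * T2 - t * y2) := by
  by_contra hcon
  push Not at hcon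
  set W := h ^ 2 + t ^ 2 with hWd
  have w0 : W * ρ0 ^ 2 = (y0 * h + T0 * t) ^ 2 + (h * T0 - t * y0) ^ 2 := by rw [hρ0]; ring
  have w2 : W * ρ2 ^ 2 = (y2 * h + T2 * t) ^ 2 + (h * T2 - t * y2) ^ 2 := by rw [hρ2]; ring
  set β0 := h * T0 - t * y0
  set β2 := h * T2 - t * y2
  set α0 := y0 * h + T0 * t
  set α2 := y2 * h + T2 * t
  have hWp : 0 < W := lt_of_le_of_lt (by positivity) hW
  have hβ2 : 0 < β2 := lt_of_lt_of_le hβ0 hβ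
  have q0 : 0 < ρ0 := by
    rcases p0.lt_or_eq with h | h
    · exact h
    · rw [← h] at w0; linarith [sq_nonneg α0, pow_pos hβ0 2]
  have q2 : 0 < ρ2 := by
    rcases p2.lt_or_eq with h | h
    · exact h
    · rw [← h] at w2; linarith [sq_nonneg α2, pow_pos hβ2 2]
  set s := Real.sqrt W with hs
  have hsp : 0 < s := Real.sqrt_pos.2 hWp
  have hss : s ^ 2 = W := Real.sq_sqrt hWp.le
  have hkt : |κ * t| < s := by
    apply abs_lt_of_sq_lt_sq _ hsp.le
    rw [hss, mul_pow]; exact hW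
  have ha0 : |α0| ≤ s * ρ0 := by
    apply abs_le_of_sq_le_sq _ (by positivity)
    rw [mul_pow, hss, w0]; linarith [sq_nonneg β0]
  have ha2 : |α2| ≤ s * ρ2 := by
    apply abs_le_of_sq_le_sq _ (by positivity)
    rw [mul_pow, hss, w2]; linarith [sq_nonneg β2]
  have hAB : |α0 * β2 + α2 * β0| ≤ s * (ρ0 * β2 + ρ2 * β0) := by
    refine (abs_add_le _ _).trans ?_
    rw [abs_mul, abs_mul, abs_of_pos hβ0, abs_of_pos hβ2]
    linarith [mul_le_mul_of_nonneg_right ha0 hβ2.le, mul_le_mul_of_nonneg_right ha2 hβ0.le]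
  set D := ρ0 * β2 - ρ2 * β0 with hD
  set P := ρ0 * β2 + ρ2 * β0 with hP
  have hPp : 0 < P := by positivity
  set δ := α2 * β0 - α0 * β2 with hδ
  have hδp : 0 < δ := by simp only [hδ]; linarith
  have h1 : κ * t * D ≤ -δ := by
    have : κ * t * D = -δ - μ * (β2 - β0) := by
      simp only [hD, hδ]; rw [e0, e2]; ring
    rw [this]; linarith [mul_nonneg hμ (sub_nonneg.2 hβ)]
  have h2 : W * D * P = -δ * (α0 * β2 + α2 * β0) := by
    simp only [hD, hP, hδ]
    linear_combination β2 ^ 2 * w0 - β0 ^ 2 * w2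
  have h3 : δ ≤ |κ * t| * |D| := by
    rw [← abs_mul]; have := neg_abs_le (κ * t * D); linarith
  have hDp : 0 < |D| := by
    rcases (abs_nonneg D).lt_or_eq with h | h
    · exact h
    · rw [← h] at h3; linarith
  have h4 : W * |D| * P ≤ δ * (s * P) := by
    have : W * |D| * P = |W * D * P| := by
      rw [abs_mul, abs_mul, abs_of_pos hWp, abs_of_pos hPp]
    rw [this, h2, abs_mul, abs_neg, abs_of_pos hδp]
    exact mul_le_mul_of_nonneg_left hAB hδp.le
  have h5 : s * |D| ≤ δ := by
    have : s * |D| * (s * P) ≤ δ * (s * P) := by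
      calc _ = s ^ 2 * |D| * P := by ring
        _ ≤ _ := by rw [hss]; exact h4
    exact le_of_mul_le_mul_right this (by positivity)
  linarith [mul_lt_mul_of_pos_right hkt hDp]

lemma theta_aux {κ h t y0 T0 ρ0 y2 T2 ρ2 μ : ℝ} (hρ0 : ρ0 ^ 2 = y0 ^ 2 + T0 ^ 2) (p0 : 0 ≤ ρ0)
    (hρ2 : ρ2 ^ 2 = y2 ^ 2 + T2 ^ 2) (p2 : 0 ≤ ρ2) (hW : κ ^ 2 * t ^ 2 < h ^ 2 + t ^ 2)
    (hμ : 2 * μ = h ^ 2 + t ^ 2 - κ ^ 2 * t ^ 2)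
    (e0 : y0 * h + T0 * t = κ * t * ρ0 + μ) (e2 : y2 * h + T2 * t = κ * t * ρ2 + μ)
    (r0 : 0 ≤ ρ0 - κ * t) (r2 : 0 ≤ ρ2 - κ * t)
    (hβ0 : 0 < h * T0 - t * y0) (hβ : h * T0 - t * y0 ≤ h * T2 - t * y2) :
    ∃ θ ∈ Set.Icc (0 : ℝ) 1, (y0 - θ * h) * (T2 - θ * t) = (y2 - θ * h) * (T0 - θ * t) := by
  have hμ0 : 0 ≤ μ := by linarith
  have c1 := cross_aux hρ0 p0 hρ2 p2 hW e0 e2 hμ0 hβ0 hβ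
  have c2 := cross_aux (κ := κ) (h := h) (t := -t) (y0 := h - y0) (T0 := T0 - t) (ρ0 := ρ0 - κ * t)
    (y2 := h - y2) (T2 := T2 - t) (ρ2 := ρ2 - κ * t) (μ := μ) (by linear_combination hρ0 + 2 * e0 + hμ) r0
    (by linear_combination hρ2 + 2 * e2 + hμ) r2
    (by rw [neg_sq]; exact hW) (by linear_combination -e0 - hμ) (by linear_combination -e2 - hμ) hμ0
    (by linarith) (by linarith)
  have hWp : 0 < h ^ 2 + t ^ 2 := lt_of_le_of_lt (by positivity) hW
  rcases hβ.lt_or_eq with hlt | heq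
  · set f0 := y0 * T2 - y2 * T0 with hf0
    set f1 := (y0 - h) * (T2 - t) - (y2 - h) * (T0 - t) with hf1
    have k0 : 0 ≤ f0 := by
      have : 0 ≤ (h ^ 2 + t ^ 2) * f0 := by simp only [hf0]; linarith
      exact nonneg_of_mul_nonneg_right this hWp
    have k1 : f1 ≤ 0 := by
      have : 0 ≤ (h ^ 2 + t ^ 2) * (-f1) := by simp only [hf1]; linarith
      have := nonneg_of_mul_nonneg_right this hWp
      linarith
    have k2 : 0 < f0 - f1 := by simp only [hf0, hf1]; linarith
    refine ⟨f0 / (f0 - f1), ⟨by positivity, by rw [div_le_one k2]; linarith⟩, ?_⟩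
    have k3 : f0 / (f0 - f1) * (f0 - f1) = f0 := div_mul_cancel₀ _ k2.ne'
    set θ := f0 / (f0 - f1)
    have : f0 - θ * (f0 - f1) = 0 := by linarith
    simp only [hf0, hf1] at this
    linear_combination this
  · refine ⟨0, by simp, ?_⟩
    have c3 := cross_aux hρ2 p2 hρ0 p0 hW e2 e0 hμ0 (heq ▸ hβ0) heq.ge
    have : (h ^ 2 + t ^ 2) * (y0 * T2 - y2 * T0) = 0 := by linarith
    have := (mul_eq_zero.1 this).resolve_left hWp.ne'
    linarith

lemma theta_aux2 {κ h t y0 T0 ρ0 y2 T2 ρ2 μ : ℝ} (hρ0 : ρ0 ^ 2 = y0 ^ 2 + T0 ^ 2) (p0 : 0 ≤ ρ0)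
    (hρ2 : ρ2 ^ 2 = y2 ^ 2 + T2 ^ 2) (p2 : 0 ≤ ρ2) (hW : κ ^ 2 * t ^ 2 < h ^ 2 + t ^ 2)
    (hμ : 2 * μ = h ^ 2 + t ^ 2 - κ ^ 2 * t ^ 2)
    (e0 : y0 * h + T0 * t = κ * t * ρ0 + μ) (e2 : y2 * h + T2 * t = κ * t * ρ2 + μ)
    (r0 : 0 ≤ ρ0 - κ * t) (r2 : 0 ≤ ρ2 - κ * t)
    (hβ0 : 0 < h * T0 - t * y0) (hβ2 : 0 < h * T2 - t * y2) :
    ∃ θ ∈ Set.Icc (0 : ℝ) 1, (y0 - θ * h) * (T2 - θ * t) = (y2 - θ * h) * (T0 - θ * t) := by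
  rcases le_total (h * T0 - t * y0) (h * T2 - t * y2) with hh | hh
  · exact theta_aux hρ0 p0 hρ2 p2 hW hμ e0 e2 r0 r2 hβ0 hh
  · obtain ⟨θ, h1, h2⟩ := theta_aux hρ2 p2 hρ0 p0 hW hμ e2 e0 r2 r0 hβ2 hh
    exact ⟨θ, h1, h2.symm⟩

lemma beta_pos {κ h t y T ρ : ℝ} (hκ : 1 < κ) (hh : 0 < h) (hT : 0 < T) (hρ : ρ ^ 2 = y ^ 2 + T ^ 2)
    (p : 0 ≤ ρ) (hc : ρ < κ * T) (hW : κ ^ 2 * t ^ 2 < h ^ 2 + t ^ 2) : 0 < h * T - t * y := by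
  have hK := Kpos hκ
  have h1 : y ^ 2 < (κ ^ 2 - 1) * T ^ 2 := by nlinarith
  have h2 : (κ ^ 2 - 1) * t ^ 2 < h ^ 2 := by nlinarith
  have h3 : (t * y) ^ 2 < (h * T) ^ 2 := by
    have a : (κ ^ 2 - 1) * (t * y) ^ 2 ≤ (κ ^ 2 - 1) * ((κ ^ 2 - 1) * t ^ 2 * T ^ 2) := by
      have := mul_le_mul_of_nonneg_left h1.le (mul_nonneg hK.le (sq_nonneg t))
      nlinarith
    have b := le_of_mul_le_mul_left a hK
    have c := mul_lt_mul_of_pos_right h2 (pow_pos hT 2)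
    nlinarith
  have := (abs_lt_of_sq_lt_sq' h3 (by positivity)).2
  linarith

lemma theta_aux3 {κ h t y0 T0 ρ0 y2 T2 ρ2 μ : ℝ} (hκ : 1 < κ) (hh : h ≠ 0)
    (hρ0 : ρ0 ^ 2 = y0 ^ 2 + T0 ^ 2) (p0 : 0 ≤ ρ0)
    (hρ2 : ρ2 ^ 2 = y2 ^ 2 + T2 ^ 2) (p2 : 0 ≤ ρ2) (hW : κ ^ 2 * t ^ 2 < h ^ 2 + t ^ 2)
    (hμ : 2 * μ = h ^ 2 + t ^ 2 - κ ^ 2 * t ^ 2)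
    (e0 : y0 * h + T0 * t = κ * t * ρ0 + μ) (e2 : y2 * h + T2 * t = κ * t * ρ2 + μ)
    (r0 : 0 ≤ ρ0 - κ * t) (r2 : 0 ≤ ρ2 - κ * t) (hT0 : 0 < T0) (hT2 : 0 < T2)
    (c0 : ρ0 < κ * T0) (c2 : ρ2 < κ * T2) :
    ∃ θ ∈ Set.Icc (0 : ℝ) 1, (y0 - θ * h) * (T2 - θ * t) = (y2 - θ * h) * (T0 - θ * t) := by
  rcases hh.lt_or_gt with hn | hp
  · have hρ0' : ρ0 ^ 2 = (-y0) ^ 2 + T0 ^ 2 := by rw [neg_sq]; exact hρ0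
    have hρ2' : ρ2 ^ 2 = (-y2) ^ 2 + T2 ^ 2 := by rw [neg_sq]; exact hρ2
    have hW' : κ ^ 2 * t ^ 2 < (-h) ^ 2 + t ^ 2 := by rw [neg_sq]; exact hW
    have hn' : 0 < -h := by linarith
    obtain ⟨θ, h1, h2⟩ := theta_aux2 (μ := μ) hρ0' p0 hρ2' p2 hW' (by rw [neg_sq]; exact hμ)
      (by linarith) (by linarith) r0 r2 (beta_pos hκ hn' hT0 hρ0' p0 c0 hW')
      (beta_pos hκ hn' hT2 hρ2' p2 c2 hW')
    exact ⟨θ, h1, by linarith⟩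
  · exact theta_aux2 hρ0 p0 hρ2 p2 hW hμ e0 e2 r0 r2 (beta_pos hκ hp hT0 hρ0 p0 c0 hW)
      (beta_pos hκ hp hT2 hρ2 p2 c2 hW)

lemma hypb_continuous_x {n : ℕ} (κ : ℝ) (Y : E n × ℝ) (b : ℝ) :
    Continuous (fun x : E n => hypb κ Y b x) := by
  unfold hypb
  fun_prop

lemma hypb_nonneg {n : ℕ} {κ b Δ : ℝ} (hκ : 1 < κ) {Y : E n × ℝ} (hY : 0 ≤ Y.2)
    (hb : b ≤ κ * Y.2 - Real.sqrt (Y.2 ^ 2 + Δ ^ 2)) {z : E n} (hz : ‖z - Y.1‖ ≤ Δ) :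
    0 ≤ hypb κ Y b z := by
  have hK := Kpos hκ
  rw [hypb_eq hκ]
  have hs0 := Real.sqrt_nonneg (Y.2 ^ 2 + Δ ^ 2)
  have hs := Real.sq_sqrt (show 0 ≤ Y.2 ^ 2 + Δ ^ 2 by positivity)
  have hr : ‖z - Y.1‖ ^ 2 ≤ Δ ^ 2 := pow_le_pow_left₀ (norm_nonneg _) hz 2
  set s := Real.sqrt (Y.2 ^ 2 + Δ ^ 2)
  set r := ‖z - Y.1‖
  have hsT : Y.2 ≤ s := le_of_sq_le_sq0 (by nlinarith [sq_nonneg Δ]) hs0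
  have h0 : 0 ≤ (κ ^ 2 - 1) * Y.2 - κ * b := by
    have : κ * b ≤ κ * (κ * Y.2 - s) := mul_le_mul_of_nonneg_left hb (by linarith)
    nlinarith
  have h1 : s ^ 2 ≤ (κ * Y.2 - b) ^ 2 := pow_le_pow_left₀ hs0 (by linarith) 2
  have h2 : Real.sqrt (b ^ 2 + (κ ^ 2 - 1) * r ^ 2) ≤ (κ ^ 2 - 1) * Y.2 - κ * b := by
    apply Real.sqrt_le_iff.2 ⟨h0, ?_⟩
    have h3 : 0 ≤ (κ ^ 2 - 1) * ((κ * Y.2 - b) ^ 2 - Y.2 ^ 2 - r ^ 2) :=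
      mul_nonneg hK.le (by linarith)
    linarith
  have h4 : Y.2 - κ * b / (κ ^ 2 - 1) - Real.sqrt (b ^ 2 + (κ ^ 2 - 1) * r ^ 2) / (κ ^ 2 - 1)
    = ((κ ^ 2 - 1) * Y.2 - κ * b - Real.sqrt (b ^ 2 + (κ ^ 2 - 1) * r ^ 2)) / (κ ^ 2 - 1) := by
    field_simp
  rw [h4]
  exact div_nonneg (by linarith) hK.le

lemma hyp_val {n : ℕ} {κ t : ℝ} (hκ : 1 < κ) {X Y : E n × ℝ} {z : E n}
    (ht : hyp κ z Y X = X.2 + t) :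
    2 * ⟪z - X.1, Y.1 - X.1⟫ = 2 * t * qf κ X Y + ‖z - X.1‖ ^ 2 - (κ ^ 2 - 1) * t ^ 2 ∧
      0 ≤ qf κ X Y - (κ ^ 2 - 1) * t := by
  have hK := Kpos hκ
  rw [hyp_eq hκ] at ht
  have hn := norm_shift z X.1 Y.1
  have hq := qf_sq κ X Y
  rw [norm_sub_rev Y.1 X.1] at hq
  have harg : 0 ≤ qf κ X Y ^ 2 + (κ ^ 2 - 1) * (‖z - X.1‖ ^ 2 - 2 * ⟪z - X.1, Y.1 - X.1⟫) := by
    have : 0 ≤ cfun κ X Y ^ 2 + (κ ^ 2 - 1) * ‖z - Y.1‖ ^ 2 := by positivity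
    rw [hn] at this
    rw [hq]
    linarith
  have h1 := Real.sqrt_nonneg (qf κ X Y ^ 2 + (κ ^ 2 - 1) * (‖z - X.1‖ ^ 2 - 2 * ⟪z - X.1, Y.1 - X.1⟫))
  have h2 := Real.sq_sqrt harg
  set S := Real.sqrt (qf κ X Y ^ 2 + (κ ^ 2 - 1) * (‖z - X.1‖ ^ 2 - 2 * ⟪z - X.1, Y.1 - X.1⟫))
  have h3 : qf κ X Y - S = (κ ^ 2 - 1) * t := by
    have : (qf κ X Y - S) / (κ ^ 2 - 1) = t := by linarith
    field_simp at this
    linarith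
  have h4 : S = qf κ X Y - (κ ^ 2 - 1) * t := by linarith
  refine ⟨?_, by linarith⟩
  rw [h4] at h2
  apply mul_left_cancel₀ hK.ne'
  linarith

lemma hyp_strict {n : ℕ} {κ t : ℝ} (hκ : 1 < κ) {X Y : E n × ℝ} {z : E n} (hT : X.2 < Y.2)
    (hc : 0 < cfun κ X Y) (hz : z ≠ X.1)
    (ht : hyp κ z Y X = X.2 + t) : (κ ^ 2 - 1) * t ^ 2 < ‖z - X.1‖ ^ 2 := by
  have hK := Kpos hκ
  have hle : (κ ^ 2 - 1) * t ^ 2 ≤ ‖z - X.1‖ ^ 2 := by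
    have h := hypb_lip hκ Y (cfun κ X Y) z X.1
    have h1 := hyp_self hκ hT
    unfold hyp at h1 ht
    rw [h1, ht] at h
    simpa using h
  refine lt_of_le_of_ne hle fun heq => ?_
  have hp : 0 < ‖z - X.1‖ ^ 2 := pow_pos (norm_pos_iff.2 (sub_ne_zero.2 hz)) 2
  obtain ⟨h1, -⟩ := hyp_val hκ ht
  have h2 := real_inner_mul_inner_self_le (z - X.1) (Y.1 - X.1)
  rw [real_inner_self_eq_norm_sq, real_inner_self_eq_norm_sq, ← heq] at h2
  have h3 : ⟪z - X.1, Y.1 - X.1⟫ = t * qf κ X Y := by linarith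
  rw [h3] at h2
  have hq := qf_sq κ X Y
  have ht2 : 0 < t ^ 2 := by
    rw [← heq] at hp
    exact pos_of_mul_pos_right hp hK.le
  have h4 : t ^ 2 * (qf κ X Y ^ 2) = t ^ 2 * (cfun κ X Y ^ 2) + t ^ 2 * ((κ ^ 2 - 1) * ‖Y.1 - X.1‖ ^ 2) := by
    rw [hq]; ring
  have h5 : 0 < t ^ 2 * (cfun κ X Y ^ 2) := by positivity
  linarith

lemma same_ray {n : ℕ} {s : (E n × ℝ) → ℝ} (hs : ∀ d, 0 < s d) {Z Y0 Y2 d0 d2 : E n × ℝ}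
    (hd0 : pnorm d0 = 1) (hd2 : pnorm d2 = 1) (h0 : Y0 = Z + s d0 • d0) (h2 : Y2 = Z + s d2 • d2)
    {l : ℝ} (hl : 0 < l) (hr : Y0 - Z = l • (Y2 - Z)) : Y0 = Y2 := by
  have h3 : s d0 • d0 = l • (s d2 • d2) := by
    rw [h0, h2] at hr
    simpa using hr
  have h4 := congrArg pnorm h3
  rw [pnorm_smul (hs _).le, pnorm_smul hl.le, pnorm_smul (hs _).le, hd0, hd2] at h4
  have h5 : d0 = d2 := by
    have : s d0 • d0 = s d0 • d2 := by
      rw [h3, smul_smul]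
      congr 1
      linarith
    exact smul_right_injective _ (hs d0).ne' this
  rw [h0, h2, h5]

lemma inner_one (a b : E 1) : ⟪a, b⟫ = b 0 * a 0 := by
  simp [PiLp.inner_apply]

lemma norm_sq_one (a : E 1) : ‖a‖ ^ 2 = a 0 ^ 2 := by
  simp [EuclideanSpace.norm_sq_eq]

lemma no_cross {κ τ₀ τ₁ : ℝ} (hκ : 1 < κ) (hτ : τ₀ < τ₁) {Ω : Set (E 1)} (hΩconv : Convex ℝ Ω)
    {sfun : (E 1 × ℝ) → (E 1 × ℝ) → ℝ} (hspos : ∀ X d, 0 < sfun X d) {X Y0 Y2 : E 1 × ℝ}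
    (hparam0 : ∀ X : E 1 × ℝ, X.1 ∈ Ω → X.2 ∈ Set.Icc 0 τ₀ →
      ∃ d : E 1 × ℝ, pnorm d = 1 ∧ Y0 = X + sfun X d • d)
    (hparam2 : ∀ X : E 1 × ℝ, X.1 ∈ Ω → X.2 ∈ Set.Icc 0 τ₀ →
      ∃ d : E 1 × ℝ, pnorm d = 1 ∧ Y2 = X + sfun X d • d)
    (hX1 : X.1 ∈ Ω) (hX2 : X.2 ∈ Set.Icc 0 τ₀) (hY0 : τ₁ ≤ Y0.2) (hY2 : τ₁ ≤ Y2.2)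
    (hc0 : 0 < cfun κ X Y0) (hc2 : 0 < cfun κ X Y2) {z : E 1} (hz : z ∈ Ω) (hzX : z ≠ X.1)
    (heq : hyp κ z Y0 X = hyp κ z Y2 X) (hr : hyp κ z Y2 X ∈ Set.Icc 0 τ₀) : Y0 = Y2 := by
  have hK := Kpos hκ
  obtain ⟨t, ht⟩ : ∃ t, hyp κ z Y2 X = X.2 + t := ⟨_, (add_sub_cancel _ _).symm⟩
  rw [ht] at heq hr
  have hT0 : X.2 < Y0.2 := by linarith [hX2.2]
  have hT2 : X.2 < Y2.2 := by linarith [hX2.2]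
  obtain ⟨a0, b0⟩ := hyp_val hκ heq
  obtain ⟨a2, b2⟩ := hyp_val hκ ht
  have hst := hyp_strict hκ hT2 hc2 hzX ht
  have n0 := pnorm_sq (X - Y0)
  have n2 := pnorm_sq (X - Y2)
  have p0 := pnorm_nonneg (X - Y0)
  have p2 := pnorm_nonneg (X - Y2)
  unfold cfun at hc0 hc2
  unfold qf at a0 b0 a2 b2
  rw [inner_one, norm_sq_one] at a0 a2
  rw [norm_sq_one] at n0 n2 hst
  simp only [PiLp.sub_apply, Prod.fst_sub, Prod.snd_sub] at a0 a2 n0 n2 hst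
  set ρ0 := pnorm (X - Y0)
  set ρ2 := pnorm (X - Y2)
  have hh : z 0 - X.1 0 ≠ 0 := by
    intro h
    apply hzX
    ext i
    fin_cases i
    simpa using sub_eq_zero.1 h
  have r0 : 0 ≤ ρ0 - κ * t := by
    have : 0 < κ * (ρ0 - κ * t) := by linarith [hr.2]
    exact (pos_of_mul_pos_right this (by linarith)).le
  have r2 : 0 ≤ ρ2 - κ * t := by
    have : 0 < κ * (ρ2 - κ * t) := by linarith [hr.2]
    exact (pos_of_mul_pos_right this (by linarith)).le
  obtain ⟨θ, hθ, hcr⟩ := theta_aux3 (κ := κ) (h := z 0 - X.1 0) (t := t) (y0 := Y0.1 0 - X.1 0)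
    (T0 := Y0.2 - X.2) (ρ0 := ρ0) (y2 := Y2.1 0 - X.1 0) (T2 := Y2.2 - X.2) (ρ2 := ρ2)
    (μ := ((z 0 - X.1 0) ^ 2 + t ^ 2 - κ ^ 2 * t ^ 2) / 2) hκ hh (by linarith) p0 (by linarith) p2
    (by linarith) (by ring) (by linarith) (by linarith) r0 r2 (by linarith) (by linarith)
    (by linarith) (by linarith)
  set Z : E 1 × ℝ := (X.1 + θ • (z - X.1), X.2 + θ * t) with hZ
  have hZ1 : Z.1 ∈ Ω := hΩconv.add_smul_sub_mem hX1 hz hθ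
  have hZ2 : Z.2 ∈ Set.Icc 0 τ₀ := by
    have := (convex_Icc (0 : ℝ) τ₀).add_smul_sub_mem hX2 hr hθ
    simpa [hZ] using this
  obtain ⟨d0, hd0, h0⟩ := hparam0 Z hZ1 hZ2
  obtain ⟨d2, hd2, h2⟩ := hparam2 Z hZ1 hZ2
  have v0 : 0 < Y0.2 - Z.2 := by linarith [hZ2.2]
  have v2 : 0 < Y2.2 - Z.2 := by linarith [hZ2.2]
  refine same_ray (hspos Z) hd0 hd2 h0 h2 (div_pos v0 v2) ?_
  apply Prod.ext
  · ext i
    fin_cases i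
    simp only [Prod.fst_sub, Prod.smul_fst, PiLp.sub_apply, PiLp.smul_apply, smul_eq_mul, Fin.zero_eta]
    rw [div_mul_eq_mul_div, eq_div_iff v2.ne']
    simp only [hZ, PiLp.add_apply, PiLp.smul_apply, PiLp.sub_apply, smul_eq_mul]
    linear_combination hcr
  · simp only [Prod.snd_sub, Prod.smul_snd, smul_eq_mul]
    field_simp

lemma hyp_upper {n : ℕ} {κ : ℝ} (hκ : 1 < κ) {X Y : E n × ℝ} (hT : X.2 < Y.2)
    (hc : 0 < cfun κ X Y) (h : E n) : hyp κ (X.1 + h) Y X ≤ X.2 + ⟪vf κ X Y, h⟫ := by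
  have h1 := hypb_concave hκ hc Y X.1 h
  have h2 := hyp_self hκ hT
  unfold hyp at h2 ⊢
  rw [h2] at h1
  have h3 := qf_sq κ X Y
  rw [norm_sub_rev] at h3
  rw [← h3, Real.sqrt_sq (qf_pos hκ hT).le] at h1
  unfold vf
  rw [real_inner_smul_left, ← div_eq_inv_mul]
  exact h1

lemma case_one {κ Δ M τ₀ τ₁ : ℝ} (hκ : 1 < κ) (hτ₀ : 0 < τ₀) (hτ : τ₀ < τ₁) {Ω : Set (E 1)}
    (hΩo : IsOpen Ω) (hΩconv : Convex ℝ Ω)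
    {Tgt : Set (E 1 × ℝ)} (hTc : IsCompact Tgt) (hM : ∀ Y ∈ Tgt, Y.2 ≤ M)
    (hslab : ∀ Y ∈ Tgt, τ₁ ≤ Y.2)
    (hΔ : ∀ Y ∈ Tgt, ∀ z ∈ Ω, ‖z - Y.1‖ ≤ Δ)
    {u : E 1 → ℝ} (hurange : ∀ x ∈ Ω, u x ∈ Set.Icc 0 τ₀)
    (hu : ∀ x₀ ∈ Ω, ∃ Y ∈ Tgt, ∃ b : ℝ, 0 < b ∧
      b < κ * Y.2 - Real.sqrt (Y.2 ^ 2 + Δ ^ 2) ∧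
      (∀ x ∈ Ω, hypb κ Y b x ≤ u x) ∧ u x₀ = hypb κ Y b x₀)
    {sfun : (E 1 × ℝ) → (E 1 × ℝ) → ℝ} (hspos : ∀ X d, 0 < sfun X d)
    {x₀ : E 1} (hx₀ : x₀ ∈ Ω)
    (hgeo : ∀ Y ∈ Tgt, u x₀ < Y.2 ∧ 0 < cfun κ (x₀, u x₀) Y)
    (hparam : ∀ X : E 1 × ℝ, X.1 ∈ Ω → X.2 ∈ Set.Icc 0 τ₀ → ∀ Y ∈ Tgt,
      ∃ d : E 1 × ℝ, pnorm d = 1 ∧ Y = X + sfun X d • d)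
    {Y₀ : E 1 × ℝ} (hY₀ : Y₀ ∈ Tgt) {ε : ℝ} (hε : 0 < ε)
    (hloc : ∀ x ∈ Metric.ball x₀ ε, hyp κ x Y₀ (x₀, u x₀) ≤ u x) :
    ∀ x ∈ Ω, hyp κ x Y₀ (x₀, u x₀) ≤ u x := by
  intro x hx
  by_cases hxx : x = x₀
  · subst hxx
    exact (hyp_self hκ (X := (x, u x)) (hgeo Y₀ hY₀).1).le
  obtain ⟨Y, hY, hsup, hcb, hin⟩ := exists_support hκ hΩo hTc hM hu hx₀ hgeo hY₀ hε hloc (x - x₀)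
  by_cases hYY : Y₀ = Y
  · rw [hYY]; exact hsup x hx
  have hX2 := hurange x₀ hx₀
  have hnz : ∀ z ∈ Ω, z ≠ x₀ → hyp κ z Y₀ (x₀, u x₀) ≠ hyp κ z Y (x₀, u x₀) := by
    intro z hz hzx heq
    apply hYY
    refine no_cross (X := (x₀, u x₀)) hκ hτ hΩconv hspos (fun X h1 h2 => hparam X h1 h2 Y₀ hY₀)
      (fun X h1 h2 => hparam X h1 h2 Y hY) hx₀ hX2 (hslab _ hY₀) (hslab _ hY)
      (hgeo _ hY₀).2 (hgeo _ hY).2 hz hzx heq ⟨?_, (hsup z hz).trans (hurange z hz).2⟩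
    exact hypb_nonneg hκ (by linarith [hslab Y hY]) hcb (hΔ Y hY z hz)
  have hlt : ⟪vf κ (x₀, u x₀) Y₀, x - x₀⟫ < ⟪vf κ (x₀, u x₀) Y, x - x₀⟫ := by
    refine lt_of_le_of_ne hin fun heq => hYY ?_
    have hv : vf κ (x₀, u x₀) Y₀ = vf κ (x₀, u x₀) Y := by
      rw [inner_one, inner_one] at heq
      have hne : (x - x₀) 0 ≠ 0 := by
        intro h
        apply hxx
        ext i
        fin_cases i
        simpa [sub_eq_zero] using h
      have := mul_left_cancel₀ hne heq
      ext i
      fin_cases i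
      simpa using this
    obtain ⟨d0, hd0, e0⟩ := hparam (x₀, u x₀) hx₀ hX2 Y₀ hY₀
    obtain ⟨d2, hd2, e2⟩ := hparam (x₀, u x₀) hx₀ hX2 Y hY
    have k0 := YofZ_vf hκ (hgeo Y₀ hY₀).1 (hgeo Y₀ hY₀).2 (hspos _ d0) hd0 e0
    have k2 := YofZ_vf hκ (hgeo Y hY).1 (hgeo Y hY).2 (hspos _ d2) hd2 e2
    rw [← k0, hv, k2]
  by_contra hcon
  push Not at hcon
  have hx1 : hyp κ x Y (x₀, u x₀) < hyp κ x Y₀ (x₀, u x₀) := lt_of_le_of_lt (hsup x hx) hcon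
  set F : ℝ → ℝ := fun r => hyp κ (x₀ + r • (x - x₀)) Y₀ (x₀, u x₀) -
    hyp κ (x₀ + r • (x - x₀)) Y (x₀, u x₀) with hF
  have hFc : Continuous F := by
    have hl : Continuous fun r : ℝ => x₀ + r • (x - x₀) := by fun_prop
    unfold hyp at hF
    exact ((hypb_continuous_x κ Y₀ _).comp hl).sub ((hypb_continuous_x κ Y _).comp hl)
  set δ := ⟪vf κ (x₀, u x₀) Y, x - x₀⟫ - ⟪vf κ (x₀, u x₀) Y₀, x - x₀⟫ with hδ
  have hδp : 0 < δ := sub_pos.2 hlt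
  have hqp : 0 < qf κ (x₀, u x₀) Y := qf_pos hκ (hgeo Y hY).1
  set C := ‖x - x₀‖ ^ 2 / (2 * qf κ (x₀, u x₀) Y) with hC
  have hC0 : 0 ≤ C := by positivity
  have hFneg : ∃ r, 0 < r ∧ r ≤ 1 ∧ F r < 0 := by
    have hb : ∀ r : ℝ, F r ≤ -(r * δ) + r ^ 2 * C := by
      intro r
      have a1 := hyp_upper hκ (X := (x₀, u x₀)) (hgeo Y₀ hY₀).1 (hgeo Y₀ hY₀).2 (r • (x - x₀))
      have a2 := hyp_lower hκ (X := (x₀, u x₀)) (hgeo Y hY).1 (r • (x - x₀))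
      rw [real_inner_smul_right] at a1 a2
      rw [norm_smul, mul_pow, Real.norm_eq_abs, sq_abs, mul_div_assoc] at a2
      simp only [hF, hδ]
      linarith
    refine ⟨min 1 (δ / (2 * (C + 1))), by positivity, min_le_left _ _, ?_⟩
    have h1 : min 1 (δ / (2 * (C + 1))) ≤ δ / (2 * (C + 1)) := min_le_right _ _
    have h0 : 0 < min 1 (δ / (2 * (C + 1))) := by positivity
    refine lt_of_le_of_lt (hb _) ?_
    set r := min 1 (δ / (2 * (C + 1)))
    rw [le_div_iff₀ (by positivity)] at h1
    have : r * C < δ := by nlinarith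
    nlinarith
  obtain ⟨r, hr0, hr1, hFr⟩ := hFneg
  have hF1 : 0 < F 1 := by
    simp only [hF, one_smul, add_sub_cancel]
    linarith
  obtain ⟨c, hc, hc0⟩ := intermediate_value_Icc hr1 hFc.continuousOn ⟨hFr.le, hF1.le⟩
  have hcp : 0 < c := lt_of_lt_of_le hr0 hc.1
  refine hnz (x₀ + c • (x - x₀)) (hΩconv.add_smul_sub_mem hx₀ hx ⟨hcp.le, hc.2⟩) ?_
    (sub_eq_zero.1 hc0)
  intro h
  have := smul_eq_zero.1 (add_eq_left.1 h)
  rcases this with h | h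
  · exact hcp.ne' h
  · exact hxx (sub_eq_zero.1 h)

/-- under condition (AW) from X₀ = (x₀, u(x₀)), a locally supporting
hyperboloid supports the refractor globally. -/
theorem stmt_13 {n : ℕ} (hn : 1 ≤ n) (κ : ℝ) (hκ : 1 < κ)
    (Ω : Set (E n)) (hΩo : IsOpen Ω) (hΩconv : Convex ℝ Ω)
    (hΩb : Bornology.IsBounded Ω) (hΩne : Ω.Nonempty)
    (Tgt : Set (E n × ℝ)) (hTc : IsCompact Tgt) (hTne : Tgt.Nonempty)
    (τ₀ τ₁ ω Δ : ℝ) (hτ₀ : 0 < τ₀) (hτ : τ₀ < τ₁) (hω : 0 < ω) (hΔpos : 0 < Δ)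
    (hslab : ∀ Y ∈ Tgt, Y.2 ∈ Set.Icc τ₁ (τ₁ + ω))
    (hΔ : ∀ Y ∈ Tgt, Metric.diam (Ω ∪ {Y.1}) ≤ Δ)
    (hcompat : max (κ * τ₀) (τ₀ + κ * Δ / (κ - 1)) ≤ τ₁)
    (u : E n → ℝ) (hurange : ∀ x ∈ Ω, u x ∈ Set.Icc 0 τ₀)
    (hu : ∀ x₀ ∈ Ω, ∃ Y ∈ Tgt, ∃ b : ℝ, 0 < b ∧
      b < κ * Y.2 - Real.sqrt (Y.2 ^ 2 + Δ ^ 2) ∧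
      (∀ x ∈ Ω, hypb κ Y b x ≤ u x) ∧ u x₀ = hypb κ Y b x₀)
    (sfun : (E n × ℝ) → (E n × ℝ) → ℝ)
    (hspos : ∀ X d, 0 < sfun X d)
    (hslip : ∀ X : E n × ℝ, ∃ K : NNReal, LipschitzWith K (sfun X))
    (hparam : ∀ X : E n × ℝ, X.1 ∈ Ω → X.2 ∈ Set.Icc 0 τ₀ → ∀ Y ∈ Tgt,
      ∃ d : E n × ℝ, pnorm d = 1 ∧ Y = X + sfun X d • d)
    (x₀ : E n) (hx₀ : x₀ ∈ Ω)
    (hC2 : ContDiffOn ℝ 2 (fun v : E n => YofZ κ sfun (x₀, u x₀) v)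
      {v : E n | (κ ^ 2 - 1) * ‖v‖ ^ 2 < 1})
    (hAW : ∀ v : E n, (κ ^ 2 - 1) * ‖v‖ ^ 2 < 1 → ∀ ξ η : E n, ⟪ξ, η⟫ = 0 →
      0 ≤ fderiv ℝ (fun w : E n => fderiv ℝ
            (fun v' : E n =>
              hess (fun z => hyp κ z (YofZ κ sfun (x₀, u x₀) v') (x₀, u x₀)) x₀ η η)
            w ξ) v ξ)
    (Y₀ : E n × ℝ) (hY₀ : Y₀ ∈ Tgt) (ε : ℝ) (hε : 0 < ε)
    (hloc : ∀ x ∈ Metric.ball x₀ ε, hyp κ x Y₀ (x₀, u x₀) ≤ u x) :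
    ∀ x ∈ Ω, hyp κ x Y₀ (x₀, u x₀) ≤ u x := by
  have hκ1 : 0 < κ - 1 := by linarith
  have hτ1 : τ₀ + κ * Δ / (κ - 1) ≤ τ₁ := (le_max_right _ _).trans hcompat
  have hdist : ∀ Y ∈ Tgt, ∀ z ∈ Ω, ‖z - Y.1‖ ≤ Δ := by
    intro Y hY z hz
    rw [← dist_eq_norm]
    exact (Metric.dist_le_diam_of_mem (hΩb.union Bornology.isBounded_singleton)
      (Or.inl hz) (Or.inr rfl)).trans (hΔ Y hY)
  have hgeo : ∀ Y ∈ Tgt, u x₀ < Y.2 ∧ 0 < cfun κ (x₀, u x₀) Y := by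
    intro Y hY
    have h1 := (hurange x₀ hx₀).2
    have h2 := (hslab Y hY).1
    refine ⟨by linarith, cfun_pos hκ hΔpos (hdist Y hY x₀ hx₀) ?_⟩
    have h3 : κ * Δ / (κ - 1) ≤ Y.2 - u x₀ := by linarith
    rw [div_le_iff₀ hκ1] at h3
    show κ * Δ ≤ (κ - 1) * (Y.2 - u x₀)
    linarith
  rcases hn.lt_or_eq with h2 | h1
  · exact case_two h2 hκ hΩo hTc (fun Y hY => (hslab Y hY).2) hu hspos hx₀ hgeo
      (fun Y hY => hparam (x₀, u x₀) hx₀ (hurange x₀ hx₀) Y hY) hC2 hAW hY₀ hε hloc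
  · subst h1
    exact case_one hκ hτ₀ hτ hΩo hΩconv hTc (fun Y hY => (hslab Y hY).2)
      (fun Y hY => (hslab Y hY).1) hdist hurange hu hspos hx₀ hgeo hparam hY₀ hε hloc
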